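/- arXiv:2209.14978 — 4 statements merged into one kernel-verified Lean document; each statement's English description precedes it below -/
import Mathlib

section
/- Let k, s be positive integers with k ≤ 2s and s ≤ k−2 (i.e. ⌈k/2⌉ ≤ s ≤ k−2). Then the numbers of vertices b_n^{(k,s)} satisfy the linear recurrence b_{n+2}^{(k,s)} − k·b_{n+1}^{(k,s)} + (k−s)(k−s−1)·b_n^{(k,s)} = 0 for all n ≥ 1, with initial values b_1^{(k,s)} = k and b_2^{(k,s)} = k² − (k−s)(k−s−1). -/
open Pointwise

/-- The window `λ_i = {s·i, …, s·i+k−1}` simplex-sum polytope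
`P_{n,k,s} = Δ_{λ_0} + ⋯ + Δ_{λ_{n-1}} ⊆ ℝ^K`, `K = s(n−1)+k`. -/
noncomputable def poolPolytope (n k s : ℕ) : Set (Fin (s * (n - 1) + k) → ℝ) :=
  ∑ i ∈ Finset.range n,
    convexHull ℝ {v : Fin (s * (n - 1) + k) → ℝ |
      ∃ j : Fin (s * (n - 1) + k), s * i ≤ (j : ℕ) ∧ (j : ℕ) < s * i + k ∧
        v = Pi.single j (1 : ℝ)}

/-- `b_n^{(k,s)}`, the number of vertices (extreme points) of `P_{n,k,s}`. -/
noncomputable def numVertices (n k s : ℕ) : ℕ :=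
  Nat.card (Set.extremePoints ℝ (poolPolytope n k s))

/-- Words `x_0 … x_{n-1}` over `Fin k` recording the relative positions of the chosen elements of
the windows, such that consecutive windows never choose two distinct elements of their overlap. -/
def IsCompatible {n k : ℕ} (s : ℕ) (x : Fin n → Fin k) : Prop :=
  ∀ i j : Fin n, (i : ℕ) + 1 = j → s ≤ (x i : ℕ) → (x j : ℕ) + s < k → (x i : ℕ) = x j + s

instance {n k s : ℕ} : DecidablePred (IsCompatible (n := n) (k := k) s) := fun _ => by
  unfold IsCompatible; infer_instance

/-- The number of compatible words. -/
def compatibleCount (n k s : ℕ) : ℤ :=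
  ∑ x : Fin n → Fin k, if IsCompatible s x then 1 else 0

lemma isCompatible_cons {n k s : ℕ} (a : Fin k) (x : Fin (n + 1) → Fin k) :
    IsCompatible s (Fin.cons a x : Fin (n + 2) → Fin k) ↔
      IsCompatible s x ∧ (s ≤ (a : ℕ) → (x 0 : ℕ) + s < k → (a : ℕ) = x 0 + s) := by
  constructor
  · intro h
    refine ⟨fun i j hij => ?_, ?_⟩
    · simpa using h i.succ j.succ (by simp [hij])
    · simpa using h 0 (Fin.succ 0) (by simp)
  · rintro ⟨h, h0⟩ i j hij
    obtain ⟨j, rfl⟩ := Fin.exists_succ_eq.2 (show j ≠ 0 by rintro rfl; simp at hij)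
    induction i using Fin.cases with
    | zero =>
      have : j = 0 := by ext; simpa using hij.symm
      subst this
      simpa using h0
    | succ i => simpa using h i j (by simpa using hij)

lemma sum_fin_succ_fun {n k : ℕ} (F : (Fin (n + 1) → Fin k) → ℤ) :
    ∑ x, F x = ∑ x : Fin n → Fin k, ∑ a : Fin k, F (Fin.cons a x) := by
  rw [Finset.sum_comm, ← Fintype.sum_prod_type']
  exact (Fintype.sum_equiv (Fin.consEquiv fun _ : Fin (n + 1) => Fin k) _ _ fun _ => rfl).symm

lemma sum_admissible_letters (k s b : ℕ) :
    (∑ a : Fin k, if s ≤ (a : ℕ) → b + s < k → (a : ℕ) = b + s then (1 : ℤ) else 0) =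
      k - if b + s < k then (k : ℤ) - s - 1 else 0 := by
  rw [Fin.sum_univ_eq_sum_range
    (fun a => if s ≤ a → b + s < k → a = b + s then (1 : ℤ) else 0) k]
  split_ifs with hb
  · have : ∀ a ∈ Finset.range k, (if s ≤ a → b + s < k → a = b + s then (1 : ℤ) else 0) =
        (if a < s then 1 else 0) + if a = b + s then 1 else 0 := by
      intro a _
      split_ifs <;> omega
    rw [Finset.sum_congr rfl this, Finset.sum_add_distrib, Finset.sum_ite_eq',
      if_pos (by simpa using hb), Finset.sum_boole]
    have : {a ∈ Finset.range k | a < s} = Finset.range s := by ext; simp; omega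
    rw [this, Finset.card_range]
    ring
  · simp [hb]

lemma compatibleCount_one (k s : ℕ) : compatibleCount 1 k s = k := by
  have : ∀ x : Fin 1 → Fin k, IsCompatible s x := fun x i j hij => by omega
  simp [compatibleCount, this]

lemma compatibleCount_zero (k s : ℕ) : compatibleCount 0 k s = 1 := by
  have : ∀ x : Fin 0 → Fin k, IsCompatible s x := fun x i => i.elim0
  simp [compatibleCount, this]

lemma isCompatible_cons_of_lt {n k s : ℕ} {a : Fin k} (ha : (a : ℕ) < s) (x : Fin n → Fin k) :
    IsCompatible s (Fin.cons a x : Fin (n + 1) → Fin k) ↔ IsCompatible s x := by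
  cases n with
  | zero => exact ⟨fun _ i => i.elim0, fun _ i j hij => by omega⟩
  | succ n => rw [isCompatible_cons]; exact and_iff_left fun h => by omega

/-- The compatible words starting inside the overlap with a preceding window. -/
lemma sum_isCompatible_head {n k s : ℕ} (hs : s ≤ k) (h1 : k ≤ 2 * s) :
    (∑ x : Fin (n + 1) → Fin k, if IsCompatible s x ∧ (x 0 : ℕ) + s < k then (1 : ℤ) else 0) =
      (k - s) * compatibleCount n k s := by
  rw [sum_fin_succ_fun, compatibleCount, Finset.mul_sum]
  refine Finset.sum_congr rfl fun x _ => ?_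
  have : ∀ a : Fin k, (if IsCompatible s (Fin.cons a x : Fin (n + 1) → Fin k) ∧
      ((Fin.cons a x : Fin (n + 1) → Fin k) 0 : ℕ) + s < k then (1 : ℤ) else 0) =
      if (a : ℕ) + s < k then (if IsCompatible s x then 1 else 0) else 0 := by
    intro a
    by_cases ha : (a : ℕ) + s < k
    · simp [ha, isCompatible_cons_of_lt (show (a : ℕ) < s by omega)]
    · simp [ha]
  rw [Finset.sum_congr rfl fun a _ => this a,
    Fin.sum_univ_eq_sum_range (fun a => if a + s < k then
      (if IsCompatible s x then (1 : ℤ) else 0) else 0) k, ← Finset.sum_filter]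
  have : {a ∈ Finset.range k | a + s < k} = Finset.range (k - s) := by ext; simp; omega
  rw [this, Finset.sum_const, Finset.card_range, nsmul_eq_mul, Nat.cast_sub hs]

lemma compatibleCount_succ_succ {n k s : ℕ} (hs : s ≤ k) (h1 : k ≤ 2 * s) :
    compatibleCount (n + 2) k s =
      k * compatibleCount (n + 1) k s - (k - s) * (k - s - 1) * compatibleCount n k s := by
  have key : ((k : ℤ) - s) * (k - s - 1) * compatibleCount n k s =
      (k - s - 1) * ((k - s) * compatibleCount n k s) := by ring
  rw [key, ← sum_isCompatible_head hs h1, compatibleCount, sum_fin_succ_fun, compatibleCount,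
    Finset.mul_sum, Finset.mul_sum, ← Finset.sum_sub_distrib]
  refine Finset.sum_congr rfl fun x _ => ?_
  simp only [isCompatible_cons]
  by_cases hx : IsCompatible s x
  · simp only [hx, true_and]
    rw [sum_admissible_letters]
    split_ifs <;> ring
  · simp [hx]

/-- Heights of the chosen elements `c 0, c 1, …` making each `c i` the heaviest of its window. -/
def chainHeight (s : ℕ) (c : ℕ → ℕ) : ℕ → ℤ
  | 0 => 0
  | i + 1 =>
    if c (i + 1) = c i then chainHeight s c i
    else if s * (i + 1) ≤ c i then chainHeight s c i + 1
    else chainHeight s c i - 1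

lemma neg_le_chainHeight (s : ℕ) (c : ℕ → ℕ) (i : ℕ) : -(i : ℤ) ≤ chainHeight s c i := by
  induction i with
  | zero => simp [chainHeight]
  | succ i ih => rw [chainHeight]; split_ifs <;> push_cast <;> omega

/-- If consecutive windows never choose distinct elements of their overlap, some weight function
is maximised on each window exactly at the chosen element. -/
lemma exists_weight {n k s : ℕ} (h1 : k ≤ 2 * s) (c : ℕ → ℕ)
    (hc : ∀ i < n, s * i ≤ c i ∧ c i < s * i + k)
    (hcomp : ∀ i, i + 1 < n → s * (i + 1) ≤ c i → c (i + 1) < s * i + k → c i = c (i + 1)) :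
    ∃ w : ℕ → ℤ, ∀ i < n, ∀ j, s * i ≤ j → j < s * i + k → j ≠ c i → w j < w (c i) := by
  classical
  have near : ∀ i i', i < n → i' < n → s * i ≤ c i' → c i' < s * i + k →
      i' = i ∨ i' = i + 1 ∨ i = i' + 1 := by
    intro i i' hi hi' hl hu
    by_contra! h
    rcases lt_or_gt_of_ne h.1 with hlt | hlt
    · have h2 : i' + 2 ≤ i := by omega
      have := Nat.mul_le_mul_left s h2
      have := (hc i' hi').2
      rw [mul_add] at *
      omega
    · have h2 : i + 2 ≤ i' := by omega
      have := Nat.mul_le_mul_left s h2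
      have := (hc i' hi').1
      rw [mul_add] at *
      omega
  have heq : ∀ i i', i < n → i' < n → c i = c i' → chainHeight s c i = chainHeight s c i' := by
    intro i i' hi hi' h
    rcases near i i' hi hi' (h ▸ (hc i hi).1) (h ▸ (hc i hi).2) with rfl | rfl | rfl
    · rfl
    · rw [chainHeight, if_pos h.symm]
    · rw [chainHeight, if_pos h]
  let w : ℕ → ℤ := fun j =>
    if h : ∃ i, i < n ∧ c i = j then chainHeight s c h.choose else -n
  have hw : ∀ i < n, w (c i) = chainHeight s c i := by
    intro i hi
    have h : ∃ i', i' < n ∧ c i' = c i := ⟨i, hi, rfl⟩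
    simp only [w, dif_pos h]
    exact heq _ _ h.choose_spec.1 hi h.choose_spec.2
  refine ⟨w, fun i hi j hl hu hj => ?_⟩
  rw [hw i hi]
  by_cases h : ∃ i', i' < n ∧ c i' = j
  · obtain ⟨i', hi', rfl⟩ := h
    rw [hw i' hi']
    rcases near i i' hi hi' hl hu with rfl | rfl | rfl
    · exact absurd rfl hj
    · rw [chainHeight, if_neg hj, if_neg]
      · omega
      · intro h; exact hj (hcomp i hi' h hu).symm
    · rw [chainHeight, if_neg hj.symm, if_pos hl]
      omega
  · have := neg_le_chainHeight s c i
    simp only [w, dif_neg h]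
    omega

section MinkowskiSum

variable {E ι : Type*} [AddCommGroup E] [Module ℝ E]

lemma lt_or_eq_of_mem_convexHull {V : Set E} {l : E →ₗ[ℝ] ℝ} {v : E}
    (h : ∀ y ∈ V, y ≠ v → l y < l v) {y : E} (hy : y ∈ convexHull ℝ V) : l y < l v ∨ y = v := by
  have hconv : Convex ℝ {y | l y < l v ∨ y = v} := by
    rw [convex_iff_forall_pos]
    intro a ha b hb p q hp hq hpq
    simp only [Set.mem_ofPred_eq, map_add, map_smul, smul_eq_mul] at *
    have hlv : l v = p * l v + q * l v := by rw [← add_mul, hpq, one_mul]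
    rcases ha with ha | rfl
    · left
      have h1 := mul_lt_mul_of_pos_left ha hp
      have h2 : q * l b ≤ q * l v := by
        rcases hb with hb | rfl
        · exact (mul_lt_mul_of_pos_left hb hq).le
        · exact le_rfl
      linarith
    · rcases hb with hb | rfl
      · left
        have h1 := mul_lt_mul_of_pos_left hb hq
        linarith
      · right
        rw [← add_smul, hpq, one_smul]
  exact convexHull_min (fun y hy => or_iff_not_imp_right.2 (h y hy)) hconv hy

/-- A functional maximised exactly at `v i` on each summand is maximised over the Minkowski sum
exactly at the sum of the `v i`, in a unique way. -/
lemma eq_of_sum_le [Fintype ι] {V : ι → Set E} {l : E →ₗ[ℝ] ℝ} {v y : ι → E}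
    (h : ∀ i, ∀ y ∈ V i, y ≠ v i → l y < l (v i)) (hy : ∀ i, y i ∈ convexHull ℝ (V i))
    (hle : ∑ i, l (v i) ≤ ∑ i, l (y i)) : y = v := by
  have hi := fun i => lt_or_eq_of_mem_convexHull (h i) (hy i)
  have hi' : ∀ i ∈ Finset.univ, l (y i) ≤ l (v i) := fun i _ =>
    (hi i).elim le_of_lt fun h => h ▸ le_rfl
  have := (Finset.sum_eq_sum_iff_of_le hi').1 (le_antisymm (Finset.sum_le_sum hi') hle)
  ext i
  exact (hi i).resolve_left (this i (Finset.mem_univ i)).not_lt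

end MinkowskiSum

lemma sum_mem_extremePoints {E ι : Type*} [NormedAddCommGroup E] [NormedSpace ℝ E] [Fintype ι]
    {V : ι → Set E} {l : StrongDual ℝ E} {v : ι → E} (hv : ∀ i, v i ∈ V i)
    (h : ∀ i, ∀ y ∈ V i, y ≠ v i → l y < l (v i)) :
    ∑ i, v i ∈ (∑ i, convexHull ℝ (V i)).extremePoints ℝ := by
  apply exposedPoints_subset_extremePoints
  refine ⟨(Set.mem_fintype_sum _ _).2 ⟨v, fun i => subset_convexHull ℝ _ (hv i), rfl⟩, l, ?_⟩
  intro y hy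
  obtain ⟨z, hz, rfl⟩ := (Set.mem_fintype_sum _ _).1 hy
  simp only [map_sum]
  have key := fun hle => eq_of_sum_le (l := (l : E →ₗ[ℝ] ℝ)) h hz hle
  exact ⟨le_of_not_gt fun hlt => hlt.ne (by simp [key hlt.le]), fun hle => by simp [key hle]⟩

lemma eq_of_sum_mem_extremePoints {E ι : Type*} [AddCommGroup E] [Module ℝ E] [Fintype ι]
    {V : ι → Set E} {v : ι → E} (hv : ∀ i, v i ∈ V i)
    (hext : ∑ i, v i ∈ (∑ i, convexHull ℝ (V i)).extremePoints ℝ) {i j : ι}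
    (hi : v j ∈ V i) (hj : v i ∈ V j) : v i = v j := by
  classical
  have hmem : ∀ i j, v j ∈ V i → ∑ t, Function.update v i (v j) t ∈ ∑ i, convexHull ℝ (V i) := by
    intro i j hi
    refine (Set.mem_fintype_sum _ _).2 ⟨_, fun t => subset_convexHull ℝ _ ?_, rfl⟩
    by_cases ht : t = i
    · subst ht; simpa using hi
    · simpa [ht] using hv t
  have hsum : ∀ i j, ∑ t, Function.update v i (v j) t = ∑ t, v t + (v j - v i) := by
    intro i j
    rw [← sub_eq_iff_eq_add', ← Finset.sum_sub_distrib, Finset.sum_eq_single i]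
    · simp
    · intro t _ ht; simp [ht]
    · simp
  have h := (mem_extremePoints.1 hext).2 _ (hmem i j hi) _ (hmem j i hj)
    ⟨1 / 2, 1 / 2, by norm_num, by norm_num, by norm_num, by rw [hsum, hsum]; module⟩
  have := h.1
  rw [hsum, add_eq_left, sub_eq_zero] at this
  exact this.symm

/-- The element at position `a` of the window `λ_i`. -/
def windowIndex {n k : ℕ} (s : ℕ) (i : Fin n) (a : Fin k) : Fin (s * (n - 1) + k) :=
  ⟨s * i + a, add_lt_add_of_le_of_lt (Nat.mul_le_mul_left s (by omega)) a.2⟩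

/-- The standard basis vector at position `a` of the window `λ_i`. -/
def windowVertex {n k : ℕ} (s : ℕ) (i : Fin n) (a : Fin k) : Fin (s * (n - 1) + k) → ℝ :=
  Pi.single (windowIndex s i a) 1

lemma windowVertex_inj {n k s : ℕ} {i j : Fin n} {a b : Fin k} :
    windowVertex s i a = windowVertex s j b ↔ s * (i : ℕ) + a = s * j + b := by
  constructor
  · intro h
    have := congrFun h (windowIndex s i a)
    by_contra hne
    have hne' : windowIndex s i a ≠ windowIndex s j b := fun h => hne (congrArg Fin.val h)
    simp [windowVertex, hne'] at this
  · intro h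
    rw [windowVertex, windowVertex, show windowIndex s i a = windowIndex s j b from Fin.ext h]

lemma poolPolytope_eq (n k s : ℕ) :
    poolPolytope n k s = ∑ i : Fin n, convexHull ℝ (Set.range (windowVertex (k := k) s i)) := by
  rw [poolPolytope, Finset.sum_range]
  refine Finset.sum_congr rfl fun i _ => congrArg _ (Set.ext fun v => ⟨?_, ?_⟩)
  · rintro ⟨j, hl, hu, rfl⟩
    refine ⟨⟨j - s * i, by omega⟩, ?_⟩
    rw [windowVertex]
    congr 1
    ext
    simp only [windowIndex]
    omega
  · rintro ⟨a, rfl⟩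
    exact ⟨windowIndex s i a, by simp [windowIndex], by simp [windowIndex], rfl⟩

/-- The lattice point of the polytope given by a choice of one element in each window. -/
def choicePoint {n k : ℕ} (s : ℕ) (x : Fin n → Fin k) : Fin (s * (n - 1) + k) → ℝ :=
  ∑ i, windowVertex s i (x i)

lemma exists_functional {n k s : ℕ} (h1 : k ≤ 2 * s) {x : Fin n → Fin k} (hx : IsCompatible s x) :
    ∃ l : StrongDual ℝ (Fin (s * (n - 1) + k) → ℝ), ∀ i, ∀ y ∈ Set.range (windowVertex s i),
      y ≠ windowVertex s i (x i) → l y < l (windowVertex s i (x i)) := by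
  obtain ⟨w, hw⟩ := exists_weight (n := n) (k := k) (s := s) h1
    (fun i => s * i + if h : i < n then (x ⟨i, h⟩ : ℕ) else 0)
    (fun i hi => by simp [hi]) (fun i hi hl hu => by
      have hi' : i < n := by omega
      have := hx ⟨i, hi'⟩ ⟨i + 1, hi⟩ rfl
      simp only [hi, hi', dif_pos, mul_add, mul_one] at *
      omega)
  refine ⟨∑ t : Fin (s * (n - 1) + k), (w t : ℝ) • ContinuousLinearMap.proj t, ?_⟩
  have hl : ∀ (i : Fin n) (a : Fin k),
      (∑ t : Fin (s * (n - 1) + k), (w t : ℝ) • ContinuousLinearMap.proj (R := ℝ)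
        (φ := fun _ : Fin (s * (n - 1) + k) => ℝ) t) (windowVertex s i a) =
      w (s * i + a) := by
    intro i a
    simp [windowVertex, Pi.single_apply, windowIndex]
  rintro i _ ⟨a, rfl⟩ hne
  rw [hl, hl, Int.cast_lt]
  have := hw i i.2 (s * i + a) (by simp) (by simp)
  simp only [Fin.is_lt, dif_pos] at this
  exact this fun h => hne (windowVertex_inj.2 h)

lemma choicePoint_injOn {n k s : ℕ} (h1 : k ≤ 2 * s) :
    Set.InjOn (choicePoint s) {x : Fin n → Fin k | IsCompatible s x} := by
  intro x hx y _ hxy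
  obtain ⟨l, hl⟩ := exists_functional h1 hx
  have hsum := congrArg l hxy
  simp only [choicePoint, map_sum] at hsum
  have := eq_of_sum_le (l := (l : _ →ₗ[ℝ] ℝ)) (V := fun i => Set.range (windowVertex s i))
    (v := fun i => windowVertex s i (x i)) (y := fun i => windowVertex s i (y i)) hl
    (fun i => subset_convexHull ℝ _ (Set.mem_range_self (y i))) hsum.le
  ext i
  have := windowVertex_inj.1 (congrFun this i)
  omega

lemma extremePoints_poolPolytope {n k s : ℕ} (h1 : k ≤ 2 * s) :
    (poolPolytope n k s).extremePoints ℝ =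
      choicePoint s '' {x : Fin n → Fin k | IsCompatible s x} := by
  rw [poolPolytope_eq]
  ext v
  constructor
  · intro hv
    have hv' := hv
    rw [← convexHull_sum] at hv'
    obtain ⟨g, hg, rfl⟩ := (Set.mem_fintype_sum _ _).1 (extremePoints_convexHull_subset hv')
    choose x hx using hg
    obtain rfl : (fun i => windowVertex s i (x i)) = g := funext hx
    refine ⟨x, fun i j hij hi hj => ?_, rfl⟩
    have hij' : s * (j : ℕ) = s * i + s := by rw [← hij]; ring
    have := eq_of_sum_mem_extremePoints (i := i) (j := j) (fun i => Set.mem_range_self (x i)) hv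
      ⟨⟨x j + s, hj⟩, windowVertex_inj.2 (by simp only; omega)⟩
      ⟨⟨x i - s, by omega⟩, windowVertex_inj.2 (by simp only; omega)⟩
    have := windowVertex_inj.1 this
    omega
  · rintro ⟨x, hx, rfl⟩
    obtain ⟨l, hl⟩ := exists_functional h1 hx
    exact sum_mem_extremePoints (fun i => Set.mem_range_self (x i)) hl

lemma numVertices_eq_compatibleCount {n k s : ℕ} (h1 : k ≤ 2 * s) :
    (numVertices n k s : ℤ) = compatibleCount n k s := by
  rw [numVertices, extremePoints_poolPolytope h1, Nat.card_image_of_injOn (choicePoint_injOn h1),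
    compatibleCount, Finset.sum_boole, Nat.card_eq_fintype_card, Fintype.card_ofFinset]
  simp

/-- large strides `⌈k/2⌉ ≤ s ≤ k−2`: the numbers of vertices satisfy the
recurrence `b_{n+2} − k·b_{n+1} + (k−s)(k−s−1)·b_n = 0` with `b_1 = k` and
`b_2 = k² − (k−s)(k−s−1)`. -/
theorem numVertices_recurrence_large_strides (k s : ℕ) (hk : 0 < k) (hs : 0 < s)
    (h1 : k ≤ 2 * s) (h2 : s ≤ k - 2) :
    (∀ n : ℕ, 1 ≤ n →
      (numVertices (n + 2) k s : ℤ) - (k : ℤ) * (numVertices (n + 1) k s : ℤ)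
        + ((k : ℤ) - s) * ((k : ℤ) - s - 1) * (numVertices n k s : ℤ) = 0) ∧
    numVertices 1 k s = k ∧
    (numVertices 2 k s : ℤ) = (k : ℤ) ^ 2 - ((k : ℤ) - s) * ((k : ℤ) - s - 1) := by
  have hsk : s ≤ k := by omega
  refine ⟨fun n _ => ?_, ?_, ?_⟩
  · simp only [numVertices_eq_compatibleCount h1]
    rw [compatibleCount_succ_succ hsk h1]
    ring
  · exact_mod_cast (numVertices_eq_compatibleCount h1).trans (compatibleCount_one k s)
  · rw [numVertices_eq_compatibleCount h1, compatibleCount_succ_succ hsk h1,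
      compatibleCount_one, compatibleCount_zero]
    ring
end

section
/- Let n, k, s be positive integers with n ≥ 2 and k > s+1. Then the number of facets of P_{n,k,s} is (s+2)(n−1) + k; that is, the number of nonempty exposed faces F of P_{n,k,s} with F ≠ P_{n,k,s} and finrank ℝ (vectorSpan ℝ F) = finrank ℝ (vectorSpan ℝ P_{n,k,s}) − 1 equals (s+2)(n−1) + k. -/
open Pointwise

/-- A facet of `P_{n,k,s}`: a nonempty exposed face, different from the polytope itself, of
dimension one less than the polytope. -/
def IsFacetOfPool (n k s : ℕ) (F : Set (Fin (s * (n - 1) + k) → ℝ)) : Prop :=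
  (∃ ℓ : (Fin (s * (n - 1) + k) → ℝ) →ₗ[ℝ] ℝ,
      F = {x ∈ poolPolytope n k s | ∀ y ∈ poolPolytope n k s, ℓ y ≤ ℓ x}) ∧
    F.Nonempty ∧ F ≠ poolPolytope n k s ∧
    Module.finrank ℝ (vectorSpan ℝ F) =
      Module.finrank ℝ (vectorSpan ℝ (poolPolytope n k s)) - 1

section WindowSum

variable {ι : Type*} [Fintype ι] [DecidableEq ι]

/-- The Minkowski sum of the coordinate simplices on the sets `win 0, …, win (n - 1)`. -/
def windowSum (n : ℕ) (win : ℕ → Set ι) : Set (ι → ℝ) :=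
  ∑ i ∈ Finset.range n, convexHull ℝ {v : ι → ℝ | ∃ j ∈ win i, v = Pi.single j (1 : ℝ)}

/-- The face of `P` on which the functional with coefficients `c` is maximal. -/
def maxFace (P : Set (ι → ℝ)) (c : ι → ℝ) : Set (ι → ℝ) :=
  {x ∈ P | ∀ y ∈ P, c ⬝ᵥ y ≤ c ⬝ᵥ x}

/-- The elements of `S` at which `c` attains its maximum over `S`. -/
def argmaxOn (S : Set ι) (c : ι → ℝ) : Set ι :=
  {j ∈ S | ∀ l ∈ S, c l ≤ c j}

/-- The vectors that are constant on the set of maximizers of `c` in each window. -/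
def constOnArgmax (n : ℕ) (win : ℕ → Set ι) (c : ι → ℝ) : Submodule ℝ (ι → ℝ) where
  carrier := {d | ∀ i < n, ∀ j ∈ argmaxOn (win i) c, ∀ j' ∈ argmaxOn (win i) c, d j = d j'}
  add_mem' := by
    intro a b ha hb i hi j hj j' hj'
    simp [ha i hi j hj j' hj', hb i hi j hj j' hj']
  zero_mem' := by
    intro i hi j hj j' hj'
    rfl
  smul_mem' := by
    intro r a ha i hi j hj j' hj'
    simp [ha i hi j hj j' hj']

omit [Fintype ι] [DecidableEq ι] in
theorem mem_constOnArgmax {n : ℕ} {win : ℕ → Set ι} {c d : ι → ℝ} :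
    d ∈ constOnArgmax n win c ↔
      ∀ i < n, ∀ j ∈ argmaxOn (win i) c, ∀ j' ∈ argmaxOn (win i) c, d j = d j' :=
  Iff.rfl

omit [Fintype ι] [DecidableEq ι] in
theorem one_mem_constOnArgmax (n : ℕ) (win : ℕ → Set ι) (c : ι → ℝ) :
    1 ∈ constOnArgmax n win c := fun _ _ _ _ _ _ => rfl

omit [Fintype ι] [DecidableEq ι] in
theorem comp_mem_constOnArgmax (n : ℕ) (win : ℕ → Set ι) (c : ι → ℝ) (f : ℝ → ℝ) :
    f ∘ c ∈ constOnArgmax n win c := by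
  intro i _ j hj j' hj'
  simp [le_antisymm (hj'.2 j hj.1) (hj.2 j' hj'.1)]

theorem mem_convexHull_single {S : Set ι} {x : ι → ℝ} :
    x ∈ convexHull ℝ {v : ι → ℝ | ∃ j ∈ S, v = Pi.single j (1 : ℝ)} ↔
      (∀ j, 0 ≤ x j) ∧ (∀ j ∉ S, x j = 0) ∧ ∑ j, x j = 1 := by
  classical
  constructor
  · intro hx
    have key : convexHull ℝ {v : ι → ℝ | ∃ j ∈ S, v = Pi.single j (1 : ℝ)} ⊆
        {x | (∀ j, 0 ≤ x j) ∧ (∀ j ∉ S, x j = 0) ∧ ∑ j, x j = 1} := by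
      refine convexHull_min ?_ ?_
      · rintro v ⟨j, hj, rfl⟩
        refine ⟨fun l => ?_, fun l hl => ?_, by simp⟩
        · by_cases h : l = j
          · subst h; simp
          · simp [h]
        · have : l ≠ j := fun h => hl (h ▸ hj)
          simp [this]
      · rintro a ⟨ha1, ha2, ha3⟩ b ⟨hb1, hb2, hb3⟩ p q hp hq hpq
        refine ⟨fun l => ?_, fun l hl => ?_, ?_⟩
        · have := mul_nonneg hp (ha1 l)
          have := mul_nonneg hq (hb1 l)
          simp only [Pi.add_apply, Pi.smul_apply, smul_eq_mul]
          linarith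
        · simp [ha2 l hl, hb2 l hl]
        · simp [Finset.sum_add_distrib, ← Finset.mul_sum, ha3, hb3, hpq]
    exact key hx
  · rintro ⟨h0, hS, h1⟩
    have hx : x = ∑ j ∈ Finset.univ.filter (· ∈ S), x j • (Pi.single j (1 : ℝ) : ι → ℝ) := by
      rw [Finset.sum_filter_of_ne]
      · exact pi_eq_sum_univ' x
      · intro j _ hj
        by_contra h
        exact hj (by simp [hS j h])
    rw [hx]
    refine (convex_convexHull ℝ _).sum_mem (fun j _ => h0 j) ?_ ?_
    · rw [Finset.sum_filter_of_ne, h1]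
      intro j _ hj
      by_contra h
      exact hj (hS j h)
    · intro j hj
      exact subset_convexHull ℝ _ ⟨j, by simpa using hj, rfl⟩

theorem mem_windowSum {n : ℕ} {win : ℕ → Set ι} {x : ι → ℝ} :
    x ∈ windowSum n win ↔ ∃ w : ℕ → ι → ℝ,
      (∀ i < n, (∀ j, 0 ≤ w i j) ∧ (∀ j ∉ win i, w i j = 0) ∧ ∑ j, w i j = 1) ∧
        ∑ i ∈ Finset.range n, w i = x := by
  rw [windowSum, Set.mem_finsetSum]
  constructor
  · rintro ⟨w, hw, rfl⟩
    exact ⟨w, fun i hi => mem_convexHull_single.1 (hw (Finset.mem_range.2 hi)), rfl⟩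
  · rintro ⟨w, hw, rfl⟩
    exact ⟨w, fun {i} hi => mem_convexHull_single.2 (hw i (Finset.mem_range.1 hi)), rfl⟩

theorem sum_single_mem_windowSum {n : ℕ} {win : ℕ → Set ι} {r : ℕ → ι}
    (hr : ∀ i < n, r i ∈ win i) :
    ∑ i ∈ Finset.range n, Pi.single (r i) (1 : ℝ) ∈ windowSum n win := by
  refine mem_windowSum.2 ⟨fun i => Pi.single (r i) 1, fun i hi => ?_, rfl⟩
  exact mem_convexHull_single.1 (subset_convexHull ℝ _ ⟨r i, hr i hi, rfl⟩)

omit [DecidableEq ι] in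
theorem exists_mem_argmaxOn {S : Set ι} (hS : S.Nonempty) (c : ι → ℝ) :
    (argmaxOn S c).Nonempty := by
  obtain ⟨j, hj, h⟩ := Set.exists_max_image S c S.toFinite hS
  exact ⟨j, hj, h⟩

omit [DecidableEq ι] in
/-- If a probability vector supported on `S` is supported on the maximizers of `c`, then it
evaluates to the maximum against any vector constant on those maximizers. -/
theorem dotProduct_eq_of_support {w d : ι → ℝ} {M : Set ι} {r : ι} (h1 : ∑ j, w j = 1)
    (hM : ∀ j, w j ≠ 0 → j ∈ M) (hd : ∀ j ∈ M, d j = d r) : d ⬝ᵥ w = d r := by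
  have : d ⬝ᵥ w = ∑ j, d r * w j := by
    refine Finset.sum_congr rfl fun j _ => ?_
    by_cases h : w j = 0
    · simp [h]
    · rw [hd j (hM j h)]
  rw [this, ← Finset.mul_sum, h1, mul_one]

omit [DecidableEq ι] in
theorem dotProduct_le_of_support {w c : ι → ℝ} {S : Set ι} {r : ι} (h0 : ∀ j, 0 ≤ w j)
    (hS : ∀ j ∉ S, w j = 0) (h1 : ∑ j, w j = 1) (hr : r ∈ argmaxOn S c) : c ⬝ᵥ w ≤ c r := by
  have : c ⬝ᵥ w ≤ ∑ j, c r * w j := by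
    refine Finset.sum_le_sum fun j _ => ?_
    by_cases h : j ∈ S
    · exact mul_le_mul_of_nonneg_right (hr.2 j h) (h0 j)
    · simp [hS j h]
  rwa [← Finset.mul_sum, h1, mul_one] at this

omit [DecidableEq ι] in
theorem mem_argmaxOn_of_dotProduct_eq {w c : ι → ℝ} {S : Set ι} {r : ι} (h0 : ∀ j, 0 ≤ w j)
    (hS : ∀ j ∉ S, w j = 0) (h1 : ∑ j, w j = 1) (hr : r ∈ argmaxOn S c) (h : c ⬝ᵥ w = c r)
    {j : ι} (hj : w j ≠ 0) : j ∈ argmaxOn S c := by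
  have hsum : ∑ j, (c r - c j) * w j = 0 := by
    simp only [sub_mul, Finset.sum_sub_distrib, ← Finset.mul_sum, h1, mul_one]
    exact sub_eq_zero.2 h.symm
  have hnn : ∀ l ∈ Finset.univ, 0 ≤ (c r - c l) * w l := by
    intro l _
    by_cases hl : l ∈ S
    · exact mul_nonneg (sub_nonneg.2 (hr.2 l hl)) (h0 l)
    · simp [hS l hl]
  have hz := (Finset.sum_eq_zero_iff_of_nonneg hnn).1 hsum j (Finset.mem_univ j)
  have hc : c r = c j := by
    rcases mul_eq_zero.1 hz with h | h
    · linarith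
    · exact absurd h hj
  have hjS : j ∈ S := by
    by_contra h
    exact hj (hS j h)
  exact ⟨hjS, fun l hl => hc ▸ hr.2 l hl⟩

/-- A sum of probability vectors on the windows lies in the face of `c` iff each summand is
supported on the maximizers of `c`. -/
theorem sum_mem_maxFace_iff [Nonempty ι] {n : ℕ} {win : ℕ → Set ι}
    (hne : ∀ i < n, (win i).Nonempty)
    (c : ι → ℝ) {w : ℕ → ι → ℝ}
    (hw : ∀ i < n, (∀ j, 0 ≤ w i j) ∧ (∀ j ∉ win i, w i j = 0) ∧ ∑ j, w i j = 1) :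
    ∑ i ∈ Finset.range n, w i ∈ maxFace (windowSum n win) c ↔
      ∀ i < n, ∀ j, w i j ≠ 0 → j ∈ argmaxOn (win i) c := by
  choose! r hr using fun i (hi : i < n) => exists_mem_argmaxOn (hne i hi) c
  have hle : ∀ v : ℕ → ι → ℝ,
      (∀ i < n, (∀ j, 0 ≤ v i j) ∧ (∀ j ∉ win i, v i j = 0) ∧ ∑ j, v i j = 1) →
      ∀ i ∈ Finset.range n, c ⬝ᵥ v i ≤ c (r i) := by
    intro v hv i hi
    have hi := Finset.mem_range.1 hi
    exact dotProduct_le_of_support (hv i hi).1 (hv i hi).2.1 (hv i hi).2.2 (hr i hi)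
  constructor
  · rintro ⟨-, hmax⟩ i hi j hj
    have h := hmax _ (sum_single_mem_windowSum fun i hi => (hr i hi).1)
    simp only [dotProduct_sum, dotProduct_single, mul_one] at h
    have heq := (Finset.sum_eq_sum_iff_of_le (hle w hw)).1
      (le_antisymm (Finset.sum_le_sum (hle w hw)) h) i (Finset.mem_range.2 hi)
    exact mem_argmaxOn_of_dotProduct_eq (hw i hi).1 (hw i hi).2.1 (hw i hi).2.2 (hr i hi) heq hj
  · intro h
    refine ⟨mem_windowSum.2 ⟨w, hw, rfl⟩, fun y hy => ?_⟩
    obtain ⟨v, hv, rfl⟩ := mem_windowSum.1 hy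
    rw [dotProduct_sum, dotProduct_sum]
    refine Finset.sum_le_sum fun i hi => (hle v hv i hi).trans_eq ?_
    have hi := Finset.mem_range.1 hi
    refine (dotProduct_eq_of_support (hw i hi).2.2 (h i hi) fun j hj => ?_).symm
    exact le_antisymm ((hr i hi).2 j hj.1) (hj.2 _ (hr i hi).1)

theorem sum_single_mem_maxFace [Nonempty ι] {n : ℕ} {win : ℕ → Set ι}
    (hne : ∀ i < n, (win i).Nonempty)
    {c : ι → ℝ} {r : ℕ → ι} (hr : ∀ i < n, r i ∈ argmaxOn (win i) c) :
    ∑ i ∈ Finset.range n, Pi.single (r i) (1 : ℝ) ∈ maxFace (windowSum n win) c := by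
  refine (sum_mem_maxFace_iff hne c fun i hi => ?_).2 fun i hi j hj => ?_
  · exact mem_convexHull_single.1 (subset_convexHull ℝ _ ⟨r i, (hr i hi).1, rfl⟩)
  · by_cases h : j = r i
    · exact h ▸ hr i hi
    · simp [h] at hj

theorem maxFace_windowSum_nonempty [Nonempty ι] {n : ℕ} {win : ℕ → Set ι}
    (hne : ∀ i < n, (win i).Nonempty) (c : ι → ℝ) :
    (maxFace (windowSum n win) c).Nonempty := by
  choose! r hr using fun i (hi : i < n) => exists_mem_argmaxOn (hne i hi) c
  exact ⟨_, sum_single_mem_maxFace hne hr⟩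

theorem mem_constOnArgmax_iff [Nonempty ι] {n : ℕ} {win : ℕ → Set ι}
    (hne : ∀ i < n, (win i).Nonempty)
    {c d : ι → ℝ} : d ∈ constOnArgmax n win c ↔
      ∀ x ∈ maxFace (windowSum n win) c, ∀ y ∈ maxFace (windowSum n win) c,
        d ⬝ᵥ x = d ⬝ᵥ y := by
  constructor
  · intro hd x hx y hy
    choose! r hr using fun i (hi : i < n) => exists_mem_argmaxOn (hne i hi) c
    have key : ∀ x ∈ maxFace (windowSum n win) c, d ⬝ᵥ x = ∑ i ∈ Finset.range n, d (r i) := by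
      intro x hx
      obtain ⟨w, hw, rfl⟩ := mem_windowSum.1 hx.1
      have h := (sum_mem_maxFace_iff hne c hw).1 hx
      rw [dotProduct_sum]
      refine Finset.sum_congr rfl fun i hi => ?_
      have hi := Finset.mem_range.1 hi
      exact dotProduct_eq_of_support (hw i hi).2.2 (h i hi) fun j hj => hd i hi j hj _ (hr i hi)
    rw [key x hx, key y hy]
  · intro h i hi j hj j' hj'
    choose! r hr using fun i (hi : i < n) => exists_mem_argmaxOn (hne i hi) c
    have hmem : ∀ l ∈ argmaxOn (win i) c,
        ∑ a ∈ Finset.range n, Pi.single (Function.update r i l a) (1 : ℝ) ∈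
          maxFace (windowSum n win) c := by
      intro l hl
      refine sum_single_mem_maxFace hne fun a ha => ?_
      by_cases hai : a = i
      · subst hai; simpa using hl
      · simpa [hai] using hr a ha
    have h := h _ (hmem j hj) _ (hmem j' hj')
    simp only [dotProduct_sum, dotProduct_single, mul_one] at h
    rw [← Finset.add_sum_erase _ _ (Finset.mem_range.2 hi),
      ← Finset.add_sum_erase (Finset.range n) (fun a => d (Function.update r i j' a))
        (Finset.mem_range.2 hi)] at h
    rw [Finset.sum_congr (g := fun a => d (Function.update r i j' a)) rfl] at h
    · simpa using h
    · intro a ha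
      simp [Finset.ne_of_mem_erase ha]

theorem finrank_vectorSpan_maxFace [Nonempty ι] {n : ℕ} {win : ℕ → Set ι}
    (hne : ∀ i < n, (win i).Nonempty)
    (c : ι → ℝ) :
    Module.finrank ℝ (vectorSpan ℝ (maxFace (windowSum n win) c)) +
      Module.finrank ℝ (constOnArgmax n win c) = Fintype.card ι := by
  have h : constOnArgmax n win c =
      ((vectorSpan ℝ (maxFace (windowSum n win) c)).dualAnnihilator).comap
        (dotProductEquiv ℝ ι).toLinearMap := by
    ext d
    rw [mem_constOnArgmax_iff hne, Submodule.mem_comap, Submodule.mem_dualAnnihilator]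
    constructor
    · intro hd x hx
      rw [vectorSpan] at hx
      induction hx using Submodule.span_induction with
      | mem x hx =>
        obtain ⟨a, ha, b, hb, rfl⟩ := Set.mem_vsub.1 hx
        simp [dotProduct_sub, hd a ha b hb]
      | zero => simp
      | add a b _ _ ha hb => rw [map_add, ha, hb, add_zero]
      | smul t a _ ha => rw [map_smul, ha, smul_zero]
    · intro hd x hx y hy
      have := hd _ (vsub_mem_vectorSpan ℝ hx hy)
      simpa [dotProduct_sub, sub_eq_zero] using this
  rw [h, ← Module.finrank_fintype_fun_eq_card (R := ℝ) (η := ι),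
    ← Subspace.finrank_add_finrank_dualAnnihilator_eq
      (vectorSpan ℝ (maxFace (windowSum n win) c))]
  congr 1
  exact ((dotProductEquiv ℝ ι).ofSubmodule'
    (vectorSpan ℝ (maxFace (windowSum n win) c)).dualAnnihilator).finrank_eq

omit [Fintype ι] [DecidableEq ι] in
theorem mem_argmaxOn_indicator {S B : Set ι} {j : ι} :
    j ∈ argmaxOn S (B.indicator 1) ↔ j ∈ S ∧ (j ∈ B ∨ ∀ j' ∈ S, j' ∉ B) := by
  classical
  refine and_congr_right fun hj => ?_
  simp only [Set.indicator_apply, Pi.one_apply]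
  constructor
  · intro h
    by_contra! hcon
    obtain ⟨hjB, l, hl, hlB⟩ := hcon
    have := h l hl
    norm_num [hjB, hlB] at this
  · rintro (h | h) l hl
    · simp only [h, if_true]
      split_ifs <;> norm_num
    · simp only [h l hl, if_false]
      split_ifs <;> norm_num

omit [Fintype ι] [DecidableEq ι] in
theorem indicator_mem_constOnArgmax (n : ℕ) (win : ℕ → Set ι) (B : Set ι) :
    B.indicator 1 ∈ constOnArgmax n win (B.indicator 1) :=
  comp_mem_constOnArgmax n win _ id

/-- The proper nonempty sets `B` whose indicator functional is maximal on a facet. -/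
def IsFacetSupport (n : ℕ) (win : ℕ → Set ι) (B : Set ι) : Prop :=
  B.Nonempty ∧ Bᶜ.Nonempty ∧ ∀ d ∈ constOnArgmax n win (B.indicator 1),
    (∀ j ∈ B, ∀ j' ∈ B, d j = d j') ∧ ∀ j ∉ B, ∀ j' ∉ B, d j = d j'

omit [Fintype ι] [DecidableEq ι] in
theorem finrank_span_one_indicator {B : Set ι} (h1 : B.Nonempty) (h2 : Bᶜ.Nonempty) :
    Module.finrank ℝ (Submodule.span ℝ {(1 : ι → ℝ), B.indicator 1}) = 2 := by
  have hli : LinearIndependent ℝ ![(1 : ι → ℝ), B.indicator 1] := by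
    rw [LinearIndependent.pair_iff]
    intro a b h
    obtain ⟨x, hx⟩ := h1
    obtain ⟨y, hy⟩ := h2
    have hx' := congrFun h x
    have hy' := congrFun h y
    have hy : y ∉ B := hy
    simp [hx] at hx'
    simp [hy] at hy'
    exact ⟨hy', by simpa [hy'] using hx'⟩
  have := finrank_span_eq_card hli
  rwa [Matrix.range_cons, Matrix.range_cons, Matrix.range_empty, Set.union_empty,
    Set.singleton_union, Fintype.card_fin] at this

omit [DecidableEq ι] in
theorem isFacetSupport_iff_finrank {n : ℕ} {win : ℕ → Set ι} {B : Set ι} (h1 : B.Nonempty)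
    (h2 : Bᶜ.Nonempty) : IsFacetSupport n win B ↔
      Module.finrank ℝ (constOnArgmax n win (B.indicator 1)) = 2 := by
  have hle : Submodule.span ℝ {(1 : ι → ℝ), B.indicator 1} ≤
      constOnArgmax n win (B.indicator 1) := by
    rw [Submodule.span_le]
    rintro x (rfl | rfl)
    · exact one_mem_constOnArgmax n win _
    · exact indicator_mem_constOnArgmax n win B
  constructor
  · rintro ⟨⟨x, hx⟩, ⟨y, hy⟩, h⟩
    rw [← finrank_span_one_indicator h1 h2]
    refine congrArg (fun W : Submodule ℝ (ι → ℝ) => Module.finrank ℝ W)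
      (le_antisymm (fun d hd => ?_) hle)
    rw [Submodule.mem_span_pair]
    refine ⟨d y, d x - d y, funext fun j => ?_⟩
    by_cases hj : j ∈ B
    · simp [hj, (h d hd).1 j hj x hx]
    · simp [hj, (h d hd).2 j hj y hy]
  · intro hr
    have heq := Submodule.eq_of_le_of_finrank_eq hle
      ((finrank_span_one_indicator h1 h2).trans hr.symm)
    refine ⟨h1, h2, fun d hd => ?_⟩
    rw [← heq, Submodule.mem_span_pair] at hd
    obtain ⟨a, b, rfl⟩ := hd
    constructor <;> intro j hj j' hj' <;> simp [hj, hj']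

omit [DecidableEq ι] in
theorem maxFace_zero (P : Set (ι → ℝ)) : maxFace P 0 = P := by
  simp [maxFace]

omit [Fintype ι] [DecidableEq ι] in
theorem finrank_constOnArgmax_zero [Nonempty ι] {n : ℕ} {win : ℕ → Set ι}
    (hconn : ∀ d ∈ constOnArgmax n win 0, ∀ j j', d j = d j') :
    Module.finrank ℝ (constOnArgmax n win (0 : ι → ℝ)) = 1 := by
  have : constOnArgmax n win (0 : ι → ℝ) = Submodule.span ℝ {1} := by
    refine le_antisymm (fun d hd => ?_) ?_
    · obtain ⟨y⟩ := ‹Nonempty ι›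
      exact Submodule.mem_span_singleton.2 ⟨d y, funext fun j => by simp [hconn d hd j y]⟩
    · rw [Submodule.span_le]
      rintro x rfl
      exact one_mem_constOnArgmax n win _
  rw [this, finrank_span_singleton one_ne_zero]

theorem one_dotProduct_eq [Nonempty ι] {n : ℕ} {win : ℕ → Set ι}
    (hne : ∀ i < n, (win i).Nonempty) {x y : ι → ℝ} (hx : x ∈ windowSum n win)
    (hy : y ∈ windowSum n win) : (1 : ι → ℝ) ⬝ᵥ x = 1 ⬝ᵥ y := by
  rw [← maxFace_zero (windowSum n win)] at hx hy
  exact (mem_constOnArgmax_iff hne).1 (one_mem_constOnArgmax n win 0) x hx y hy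

theorem maxFace_smul_one_add_smul [Nonempty ι] {n : ℕ} {win : ℕ → Set ι}
    (hne : ∀ i < n, (win i).Nonempty) (a : ℝ) {b : ℝ} (hb : 0 < b) (c : ι → ℝ) :
    maxFace (windowSum n win) (a • 1 + b • c) = maxFace (windowSum n win) c := by
  ext x
  refine and_congr_right fun hx => forall₂_congr fun y hy => ?_
  simp only [add_dotProduct, smul_dotProduct, smul_eq_mul, one_dotProduct_eq hne hx hy]
  rw [add_le_add_iff_left, mul_le_mul_iff_right₀ hb]

/-- The facets of a connected sum of coordinate simplices are the faces cut out by the indicators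
of the facet supports. -/
theorem isFacet_iff_exists_isFacetSupport [Nonempty ι] {n : ℕ} {win : ℕ → Set ι}
    (hne : ∀ i < n, (win i).Nonempty)
    (hconn : ∀ d ∈ constOnArgmax n win 0, ∀ j j', d j = d j') (hcard : 2 ≤ Fintype.card ι)
    (F : Set (ι → ℝ)) :
    ((∃ ℓ : (ι → ℝ) →ₗ[ℝ] ℝ,
        F = {x ∈ windowSum n win | ∀ y ∈ windowSum n win, ℓ y ≤ ℓ x}) ∧
      F.Nonempty ∧ F ≠ windowSum n win ∧
      Module.finrank ℝ (vectorSpan ℝ F) =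
        Module.finrank ℝ (vectorSpan ℝ (windowSum n win)) - 1) ↔
    ∃ B, IsFacetSupport n win B ∧ F = maxFace (windowSum n win) (B.indicator 1) := by
  have hP := finrank_vectorSpan_maxFace hne (0 : ι → ℝ)
  rw [maxFace_zero, finrank_constOnArgmax_zero hconn] at hP
  constructor
  · rintro ⟨⟨ℓ, hF⟩, -, -, hrank⟩
    obtain ⟨c, rfl⟩ := (dotProductEquiv ℝ ι).surjective ℓ
    replace hF : F = maxFace (windowSum n win) c := hF
    have hc := finrank_vectorSpan_maxFace hne c
    rw [← hF] at hc
    have hc2 : Module.finrank ℝ (constOnArgmax n win c) = 2 := by omega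
    obtain ⟨M, hM⟩ := Finite.exists_max c
    set B : Set ι := {j | c j = c M} with hB
    have h1 : B.Nonempty := ⟨M, rfl⟩
    have h2 : Bᶜ.Nonempty := by
      by_contra hcon
      have hall : ∀ j, c j = c M := fun j => by
        by_contra hj
        exact hcon ⟨j, hj⟩
      have hc0 : constOnArgmax n win c = constOnArgmax n win 0 := by
        ext d
        simp [mem_constOnArgmax, argmaxOn, hall]
      rw [hc0, finrank_constOnArgmax_zero hconn] at hc2
      omega
    have hmem : B.indicator 1 ∈ constOnArgmax n win c := by
      classical
      have : B.indicator 1 = (fun t => if t = c M then (1 : ℝ) else 0) ∘ c := by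
        ext j
        simp [Set.indicator_apply, hB]
      rw [this]
      exact comp_mem_constOnArgmax n win c _
    have hle : Submodule.span ℝ {(1 : ι → ℝ), B.indicator 1} ≤ constOnArgmax n win c := by
      rw [Submodule.span_le]
      rintro x (rfl | rfl)
      · exact one_mem_constOnArgmax n win _
      · exact hmem
    have heq := Submodule.eq_of_le_of_finrank_eq hle
      ((finrank_span_one_indicator h1 h2).trans hc2.symm)
    have hcs : c ∈ constOnArgmax n win c := comp_mem_constOnArgmax n win c id
    rw [← heq, Submodule.mem_span_pair] at hcs
    obtain ⟨a, b, hab⟩ := hcs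
    have hb : 0 < b := by
      obtain ⟨y, hy⟩ := h2
      have hyM : c y < c M := lt_of_le_of_ne (hM y) hy
      have hy : y ∉ B := hy
      have hMB : M ∈ B := rfl
      have e1 := congrFun hab y
      have e2 := congrFun hab M
      simp only [Pi.add_apply, Pi.smul_apply, Pi.one_apply, smul_eq_mul, Set.indicator_of_mem hMB,
        Set.indicator_of_notMem hy] at e1 e2
      linarith
    have hFB : F = maxFace (windowSum n win) (B.indicator 1) := by
      rw [hF, ← maxFace_smul_one_add_smul hne a hb (B.indicator 1), hab]
    refine ⟨B, (isFacetSupport_iff_finrank h1 h2).2 ?_, hFB⟩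
    have := finrank_vectorSpan_maxFace (n := n) hne (B.indicator 1)
    rw [← hFB] at this
    omega
  · rintro ⟨B, hB, rfl⟩
    have hr := (isFacetSupport_iff_finrank hB.1 hB.2.1).1 hB
    have hc := finrank_vectorSpan_maxFace (n := n) hne (B.indicator 1)
    refine ⟨⟨dotProductEquiv ℝ ι (B.indicator 1), rfl⟩, maxFace_windowSum_nonempty hne _, ?_, ?_⟩
    · intro h
      rw [h] at hc
      omega
    · omega

theorem IsFacetSupport.eq_of_maxFace_eq [Nonempty ι] {n : ℕ} {win : ℕ → Set ι}
    (hne : ∀ i < n, (win i).Nonempty)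
    (hconn : ∀ d ∈ constOnArgmax n win 0, ∀ j j', d j = d j') {B C : Set ι}
    (hB : IsFacetSupport n win B) (hC : IsFacetSupport n win C)
    (h : maxFace (windowSum n win) (B.indicator 1) = maxFace (windowSum n win) (C.indicator 1)) :
    B = C := by
  classical
  have hmem : C.indicator 1 ∈ constOnArgmax n win (B.indicator 1) := by
    rw [mem_constOnArgmax_iff hne, h, ← mem_constOnArgmax_iff hne]
    exact indicator_mem_constOnArgmax n win C
  have hiff : ∀ {j j'}, C.indicator (1 : ι → ℝ) j = C.indicator 1 j' → (j ∈ C ↔ j' ∈ C) := by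
    intro j j' hj
    by_cases h1 : j ∈ C <;> by_cases h2 : j' ∈ C <;> simp_all
  obtain ⟨hin, hout⟩ := hB.2.2 _ hmem
  obtain ⟨⟨x, hx⟩, ⟨y, hy⟩, -⟩ := hB
  obtain ⟨⟨u, hu⟩, ⟨v, hv⟩, -⟩ := hC
  replace hin : ∀ j ∈ B, (j ∈ C ↔ x ∈ C) := fun j hj => hiff (hin j hj x hx)
  replace hout : ∀ j ∉ B, (j ∈ C ↔ y ∈ C) := fun j hj => hiff (hout j hj y hy)
  by_cases hxC : x ∈ C
  · have hyC : y ∉ C := fun hyC => hv (by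
      by_cases hvB : v ∈ B
      · exact (hin v hvB).2 hxC
      · exact (hout v hvB).2 hyC)
    ext j
    by_cases hj : j ∈ B
    · simp [hj, hin j hj, hxC]
    · simp [hj, hout j hj, hyC]
  · exfalso
    have hyC : y ∈ C := by
      by_cases huB : u ∈ B
      · exact absurd ((hin u huB).1 hu) hxC
      · exact (hout u huB).1 hu
    have hsum : C.indicator (1 : ι → ℝ) = 1 - B.indicator 1 := by
      ext j
      by_cases hj : j ∈ B
      · simp [hj, hin j hj, hxC]
      · simp [hj, hout j hj, hyC]
    obtain ⟨p, hp⟩ := maxFace_windowSum_nonempty hne (B.indicator (1 : ι → ℝ))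
    have hp' := hp
    rw [h, hsum] at hp'
    have hall : ∀ z ∈ windowSum n win,
        B.indicator (1 : ι → ℝ) ⬝ᵥ z = B.indicator (1 : ι → ℝ) ⬝ᵥ p := by
      intro z hz
      have e1 := hp.2 z hz
      have e2 := hp'.2 z hz
      rw [sub_dotProduct, sub_dotProduct, one_dotProduct_eq hne hz hp.1] at e2
      linarith
    have h0 : B.indicator 1 ∈ constOnArgmax n win (0 : ι → ℝ) := by
      rw [mem_constOnArgmax_iff hne, maxFace_zero]
      intro a ha b hb
      rw [hall a ha, hall b hb]
    have := hconn _ h0 x y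
    have hy : y ∉ B := hy
    simp [hx, hy] at this

end WindowSum

section Intervals

/-- The window of `k` consecutive indices starting at `s * i`. -/
def window (K k s i : ℕ) : Set (Fin K) := {j | s * i ≤ (j : ℕ) ∧ (j : ℕ) < s * i + k}

theorem mem_window {K k s i : ℕ} {j : Fin K} :
    j ∈ window K k s i ↔ s * i ≤ (j : ℕ) ∧ (j : ℕ) < s * i + k := Iff.rfl

theorem exists_window_index {s k : ℕ} (hs : 0 < s) (hk : s + 1 < k) (m x : ℕ) :
    ∃ i ≤ m, (∀ a ≤ m, s * a ≤ x → a ≤ i) ∧ s * i ≤ x ∧ (x + 1 < s * m + k → x + 1 < s * i + k) ∧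
      (x + 2 < s * m + k → x + 2 < s * i + k) := by
  rcases le_total (x / s) m with h | h
  · have h1 := Nat.div_add_mod x s
    have h2 := Nat.mod_lt x hs
    refine ⟨x / s, h, fun a _ ha => ?_, Nat.mul_div_le x s, by omega, by omega⟩
    rw [Nat.le_div_iff_mul_le hs, mul_comm]
    exact ha
  · refine ⟨m, le_rfl, fun a ha _ => ha, ?_, id, id⟩
    exact (Nat.mul_le_mul_left s h).trans (Nat.mul_div_le x s)

theorem eq_of_eq_succ_on_Ico {K p q : ℕ} {d : Fin K → ℝ}
    (h : ∀ x y : Fin K, p ≤ (x : ℕ) → (y : ℕ) < q → (y : ℕ) = x + 1 → d x = d y) {x y : Fin K}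
    (hx : p ≤ (x : ℕ)) (hxq : (x : ℕ) < q) (hy : p ≤ (y : ℕ)) (hyq : (y : ℕ) < q) :
    d x = d y := by
  have key : ∀ (t : ℕ) (x y : Fin K), p ≤ (x : ℕ) → (y : ℕ) < q → (y : ℕ) = x + t → d x = d y := by
    intro t
    induction t with
    | zero =>
      intro x y _ _ hxy
      rw [Fin.ext (a := x) (b := y) (by omega)]
    | succ t ih =>
      intro x y hx hy hxy
      rw [ih x ⟨x + t, by omega⟩ hx (by simp only; omega) rfl]
      exact h _ y (by simp only; omega) hy (by simp only; omega)
  rcases le_total (x : ℕ) y with hxy | hxy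
  · exact key (y - x) x y hx hyq (by omega)
  · exact (key (x - y) y x hy hxq (by omega)).symm

/-- The complements of the facet supports: singletons, proper initial unions of windows and proper
final unions of windows. -/
def facetComplement (m k s : ℕ) : Fin (s * m + k) ⊕ Fin m ⊕ Fin m → Set (Fin (s * m + k))
  | .inl j => {j}
  | .inr (.inl b) => {x | (x : ℕ) < s * b + k}
  | .inr (.inr a) => {x | s * (a + 1) ≤ (x : ℕ)}

variable {m k s : ℕ}

theorem window_nonempty (hk : 0 < k) {i : ℕ} (hi : i < m + 1) :
    (window (s * m + k) k s i).Nonempty := by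
  have := Nat.mul_le_mul_left s (Nat.le_of_lt_succ hi)
  exact ⟨⟨s * i, by omega⟩, le_rfl, by simp only; omega⟩

theorem eq_of_mem_constOnArgmax_zero (hs : 0 < s) (hk : s + 1 < k) (d : Fin (s * m + k) → ℝ)
    (hd : d ∈ constOnArgmax (m + 1) (window (s * m + k) k s) 0) (j j' : Fin (s * m + k)) :
    d j = d j' := by
  refine eq_of_eq_succ_on_Ico (p := 0) (q := s * m + k) (fun x y _ _ hxy => ?_) (Nat.zero_le _)
    j.2 (Nat.zero_le _) j'.2
  obtain ⟨i, him, -, h1, h2, -⟩ := exists_window_index hs hk m x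
  have hy := y.2
  have := h2 (by omega)
  exact hd i (by omega) x ⟨⟨h1, by omega⟩, by simp⟩ y ⟨⟨by omega, by omega⟩, by simp⟩

/-- Two points of `B` in a common window are identified by vectors constant on maximizers. -/
theorem eq_of_mem_window_of_mem {K n : ℕ} {B : Set (Fin K)} {d : Fin K → ℝ}
    (hd : d ∈ constOnArgmax n (window K k s) (B.indicator 1)) {i : ℕ} (hi : i < n)
    {x y : Fin K} (hx : x ∈ window K k s i) (hy : y ∈ window K k s i) (hxB : x ∈ B) (hyB : y ∈ B) :
    d x = d y :=
  hd i hi x (mem_argmaxOn_indicator.2 ⟨hx, .inl hxB⟩) y (mem_argmaxOn_indicator.2 ⟨hy, .inl hyB⟩)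

theorem eq_of_mem_window_of_disjoint {K n : ℕ} {B : Set (Fin K)} {d : Fin K → ℝ}
    (hd : d ∈ constOnArgmax n (window K k s) (B.indicator 1)) {i : ℕ} (hi : i < n)
    {x y : Fin K} (hx : x ∈ window K k s i) (hy : y ∈ window K k s i)
    (hB : ∀ j ∈ window K k s i, j ∉ B) : d x = d y :=
  hd i hi x (mem_argmaxOn_indicator.2 ⟨hx, .inr hB⟩) y (mem_argmaxOn_indicator.2 ⟨hy, .inr hB⟩)

theorem isFacetSupport_compl_singleton (hs : 0 < s) (hk : s + 1 < k) (j : Fin (s * m + k)) :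
    IsFacetSupport (m + 1) (window (s * m + k) k s) {j}ᶜ := by
  refine ⟨?_, ⟨j, by simp⟩, fun d hd => ⟨?_, ?_⟩⟩
  · by_cases h : (j : ℕ) = 0
    · exact ⟨⟨1, by omega⟩, by simp [Fin.ext_iff]; omega⟩
    · exact ⟨⟨0, by omega⟩, by simp [Fin.ext_iff]; omega⟩
  · have hmem : ∀ {x : Fin (s * m + k)}, (x : ℕ) ≠ j → x ∈ ({j}ᶜ : Set (Fin (s * m + k))) := by
      intro x hx h
      exact hx (congrArg _ h)
    have hstep : ∀ x y : Fin (s * m + k), (x : ℕ) ≠ j → (y : ℕ) ≠ j → (y : ℕ) = x + 1 →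
        d x = d y := by
      intro x y hx hy hxy
      obtain ⟨i, him, -, h1, h2, -⟩ := exists_window_index hs hk m x
      have := y.2
      have := h2 (by omega)
      exact eq_of_mem_window_of_mem hd (i := i) (by omega) ⟨h1, by omega⟩ ⟨by omega, by omega⟩
        (hmem hx) (hmem hy)
    have hlow : ∀ x y : Fin (s * m + k), (x : ℕ) < j → (y : ℕ) < j → d x = d y := by
      intro x y hx hy
      exact eq_of_eq_succ_on_Ico (p := 0) (q := j)
        (fun x y _ h _ => hstep x y (by omega) (by omega) ‹_›) (by omega) hx (by omega) hy
    have hhigh : ∀ x y : Fin (s * m + k), (j : ℕ) < x → (j : ℕ) < y → d x = d y := by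
      intro x y hx hy
      exact eq_of_eq_succ_on_Ico (p := j + 1) (q := s * m + k)
        (fun x y _ h _ => hstep x y (by omega) (by omega) ‹_›) hx x.2 hy y.2
    have hcross : ∀ x y : Fin (s * m + k), (x : ℕ) < j → (j : ℕ) < y → d x = d y := by
      intro x y hx hy
      have hyK := y.2
      rw [hlow x ⟨j - 1, by omega⟩ hx (by simp only; omega),
        hhigh y ⟨j + 1, by omega⟩ hy (by simp only; omega)]
      obtain ⟨i, him, -, h1, -, h2⟩ := exists_window_index hs hk m (j - 1)
      have := h2 (by omega)
      exact eq_of_mem_window_of_mem hd (i := i) (by omega) ⟨h1, by simp only; omega⟩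
        ⟨by simp only; omega, by simp only; omega⟩ (hmem (by simp only; omega))
        (hmem (by simp only; omega))
    intro x hx y hy
    have hx : (x : ℕ) ≠ j := fun h => hx (Fin.ext h)
    have hy : (y : ℕ) ≠ j := fun h => hy (Fin.ext h)
    rcases lt_or_gt_of_ne hx with hx | hx <;> rcases lt_or_gt_of_ne hy with hy | hy
    · exact hlow x y hx hy
    · exact hcross x y hx hy
    · exact (hcross y x hy hx).symm
    · exact hhigh x y hx hy
  · intro x hx y hy
    have hx : x = j := by simpa using hx
    have hy : y = j := by simpa using hy
    rw [hx, hy]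

/-- If `B` is an interval, vectors constant on maximizers are constant on `B`. -/
theorem eq_of_mem_interval (hs : 0 < s) (hk : s + 1 < k) {B : Set (Fin (s * m + k))} {p q : ℕ}
    (hB : ∀ x : Fin (s * m + k), x ∈ B ↔ p ≤ (x : ℕ) ∧ (x : ℕ) < q) {d : Fin (s * m + k) → ℝ}
    (hd : d ∈ constOnArgmax (m + 1) (window (s * m + k) k s) (B.indicator 1))
    {x y : Fin (s * m + k)} (hx : x ∈ B) (hy : y ∈ B) : d x = d y := by
  rw [hB] at hx hy
  refine eq_of_eq_succ_on_Ico (p := p) (q := q) (fun x y hx hy hxy => ?_) hx.1 hx.2 hy.1 hy.2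
  obtain ⟨i, him, -, h1, h2, -⟩ := exists_window_index hs hk m x
  have := y.2
  have := h2 (by omega)
  exact eq_of_mem_window_of_mem hd (i := i) (by omega) ⟨h1, by omega⟩ ⟨by omega, by omega⟩
    ((hB x).2 ⟨hx, by omega⟩) ((hB y).2 ⟨by omega, hy⟩)

/-- If the complement of `B` is a union of consecutive windows, vectors constant on maximizers are
constant on the complement of `B`. -/
theorem eq_of_notMem_union_windows (hs : 0 < s) (hk : s + 1 < k) {B : Set (Fin (s * m + k))}
    {a b : ℕ} (hab : a ≤ b) (hbm : b ≤ m)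
    (hB : ∀ x : Fin (s * m + k), x ∉ B ↔ s * a ≤ (x : ℕ) ∧ (x : ℕ) < s * b + k)
    {d : Fin (s * m + k) → ℝ}
    (hd : d ∈ constOnArgmax (m + 1) (window (s * m + k) k s) (B.indicator 1))
    {x y : Fin (s * m + k)} (hx : x ∉ B) (hy : y ∉ B) : d x = d y := by
  rw [hB] at hx hy
  refine eq_of_eq_succ_on_Ico (p := s * a) (q := s * b + k) (fun x y hx hy hxy => ?_)
    hx.1 hx.2 hy.1 hy.2
  obtain ⟨i, hib, ha, h1, h2, -⟩ := exists_window_index hs hk b x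
  have := h2 (by omega)
  have h3 := Nat.mul_le_mul_left s (ha a hab hx)
  have h4 := Nat.mul_le_mul_left s hib
  refine eq_of_mem_window_of_disjoint hd (i := i) (by omega) ⟨h1, by omega⟩ ⟨by omega, by omega⟩
    fun j hj => (hB j).2 ?_
  rw [mem_window] at hj
  omega

theorem isFacetSupport_facetComplement_compl (hs : 0 < s) (hk : s + 1 < k)
    (t : Fin (s * m + k) ⊕ Fin m ⊕ Fin m) :
    IsFacetSupport (m + 1) (window (s * m + k) k s) (facetComplement m k s t)ᶜ := by
  rcases t with j | b | a
  · exact isFacetSupport_compl_singleton hs hk j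
  · have hb := (Nat.mul_lt_mul_left hs).2 b.2
    refine ⟨⟨⟨s * b + k, by omega⟩, by simp [facetComplement]⟩,
      ⟨⟨0, by omega⟩, by simp [facetComplement]; omega⟩, fun d hd => ⟨?_, ?_⟩⟩
    · intro x hx y hy
      refine eq_of_mem_interval hs hk (p := s * b + k) (q := s * m + k) (fun x => ?_) hd hx hy
      simp [facetComplement]
    · intro x hx y hy
      refine eq_of_notMem_union_windows hs hk (Nat.zero_le b) b.2.le (fun x => ?_) hd hx hy
      simp [facetComplement]
  · have ha := Nat.mul_le_mul_left s (Nat.succ_le_of_lt a.2)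
    rw [Nat.succ_eq_add_one] at ha
    refine ⟨⟨⟨0, by omega⟩, by simp [facetComplement]; omega⟩,
      ⟨⟨s * (a + 1), by omega⟩, by simp [facetComplement]⟩, fun d hd => ⟨?_, ?_⟩⟩
    · intro x hx y hy
      refine eq_of_mem_interval hs hk (p := 0) (q := s * (a + 1)) (fun x => ?_) hd hx hy
      simp [facetComplement]
    · intro x hx y hy
      refine eq_of_notMem_union_windows hs hk (Nat.succ_le_of_lt a.2) le_rfl (fun x => ?_) hd hx hy
      simp [facetComplement]

theorem mem_facetComplement_inl {j x : Fin (s * m + k)} :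
    x ∈ facetComplement m k s (.inl j) ↔ (x : ℕ) = j := Fin.ext_iff

theorem mem_facetComplement_inr_inl {b : Fin m} {x : Fin (s * m + k)} :
    x ∈ facetComplement m k s (.inr (.inl b)) ↔ (x : ℕ) < s * b + k := Iff.rfl

theorem mem_facetComplement_inr_inr {a : Fin m} {x : Fin (s * m + k)} :
    x ∈ facetComplement m k s (.inr (.inr a)) ↔ s * (a : ℕ) + s ≤ (x : ℕ) := Iff.rfl

theorem facetComplement_injective (hs : 0 < s) (hk : s + 1 < k) :
    Function.Injective (facetComplement m k s) := by
  have hlt : ∀ a : Fin m, s * (a : ℕ) + s ≤ s * m := fun a => by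
    simpa [mul_add] using Nat.mul_le_mul_left s (Nat.succ_le_of_lt a.2)
  have hinj : ∀ a a' : Fin m, s * (a : ℕ) = s * (a' : ℕ) → a = a' := fun a a' h =>
    Fin.ext (Nat.eq_of_mul_eq_mul_left hs h)
  intro t t' h
  have key : ∀ x (hx : x < s * m + k), ((⟨x, hx⟩ : Fin (s * m + k)) ∈ facetComplement m k s t ↔
      (⟨x, hx⟩ : Fin (s * m + k)) ∈ facetComplement m k s t') := fun x hx => by rw [h]
  clear h
  have h0 := key 0 (by omega)
  have h1 := key 1 (by omega)
  rcases t with j | b | a <;> rcases t' with j' | b' | a' <;>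
    simp only [mem_facetComplement_inl, mem_facetComplement_inr_inl,
      mem_facetComplement_inr_inr] at key h0 h1
  · rw [Fin.ext ((key j j.2).1 rfl)]
  · omega
  · have := hlt a'
    have := key (s * a' + s) (by omega)
    have := key (s * a' + s + 1) (by omega)
    omega
  · omega
  · have := hlt b
    have := hlt b'
    have := key (s * b + k) (by omega)
    have := key (s * b' + k) (by omega)
    rw [hinj b b' (by omega)]
  · omega
  · have := hlt a
    have := key (s * a + s) (by omega)
    have := key (s * a + s + 1) (by omega)
    omega
  · omega
  · have := hlt a
    have := hlt a'
    have := key (s * a + s) (by omega)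
    have := key (s * a' + s) (by omega)
    rw [hinj a a' (by omega)]

theorem IsFacetSupport.exists_window_disjoint {K n : ℕ} {B : Set (Fin K)}
    (hB : IsFacetSupport n (window K k s) B) (hsing : ∀ j, Bᶜ ≠ {j}) {j : Fin K} (hj : j ∉ B) :
    ∃ i < n, j ∈ window K k s i ∧ ∀ j' ∈ window K k s i, j' ∉ B := by
  by_contra! hcon
  have hd : Pi.single j 1 ∈ constOnArgmax n (window K k s) (B.indicator 1) := by
    have h0 : ∀ i < n, ∀ l ∈ argmaxOn (window K k s i) (B.indicator 1), l ≠ j := by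
      rintro i hi l hl rfl
      obtain ⟨h1, h2 | h2⟩ := mem_argmaxOn_indicator.1 hl
      · exact hj h2
      · obtain ⟨l', hl', hlB⟩ := hcon i hi h1
        exact h2 l' hl' hlB
    intro i hi l hl l' hl'
    simp [h0 i hi l hl, h0 i hi l' hl']
  refine hsing j (Set.Subset.antisymm (fun l hl => ?_) (by simpa using hj))
  by_contra hlj
  have := (hB.2.2 _ hd).2 j hj l hl
  simp [show l ≠ j from hlj] at this

theorem IsFacetSupport.exists_facetComplement (hk : 0 < k) {B : Set (Fin (s * m + k))}
    (hB : IsFacetSupport (m + 1) (window (s * m + k) k s) B) :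
    ∃ t, B = (facetComplement m k s t)ᶜ := by
  by_cases hsing : ∃ j, Bᶜ = {j}
  · obtain ⟨j, hj⟩ := hsing
    exact ⟨.inl j, by rw [facetComplement, ← hj, compl_compl]⟩
  have hwin := fun {j} => hB.exists_window_disjoint (not_exists.1 hsing) (j := j)
  obtain ⟨j₀, hj₀, hmin⟩ := Set.exists_min_image Bᶜ id (Set.toFinite _) hB.2.1
  obtain ⟨a, ham, hja, ha⟩ := hwin hj₀
  rw [mem_window] at hja
  have hleft : ∀ i ≤ m, ∃ h : s * i < s * m + k,
      (⟨s * i, h⟩ : Fin (s * m + k)) ∈ window (s * m + k) k s i := by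
    intro i hi
    have := Nat.mul_le_mul_left s hi
    exact ⟨by omega, le_rfl, by simp only; omega⟩
  have hmin' : ∀ x : Fin (s * m + k), x ∉ B → s * a ≤ (x : ℕ) := by
    intro x hx
    exact hja.1.trans (hmin x hx)
  have hj₀a : (j₀ : ℕ) = s * a := by
    obtain ⟨h, hmem⟩ := hleft a (by omega)
    have : j₀ ≤ ⟨s * a, h⟩ := hmin _ (ha _ hmem)
    exact le_antisymm this hja.1
  by_cases hq : ∃ q, q ∈ B ∧ j₀ < q
  · obtain ⟨q, ⟨hqB, hjq⟩, hqmin⟩ :=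
      Set.exists_min_image {q | q ∈ B ∧ j₀ < q} id (Set.toFinite _) hq
    have hlt : ∀ x, x ∉ B → x < q := by
      have hd : {x | x < q ∧ x ∉ B}.indicator 1 ∈
          constOnArgmax (m + 1) (window (s * m + k) k s) (B.indicator 1) := by
        intro i hi l hl l' hl'
        obtain ⟨hl, h⟩ := mem_argmaxOn_indicator.1 hl
        obtain ⟨hl', h'⟩ := mem_argmaxOn_indicator.1 hl'
        by_cases hall : ∀ j ∈ window (s * m + k) k s i, j ∉ B
        · have hiff : l < q ↔ l' < q := by
            have hqi : ¬ (s * i ≤ (q : ℕ) ∧ (q : ℕ) < s * i + k) := fun h => hall q h hqB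
            rw [mem_window] at hl hl'
            simp only [Fin.lt_def]
            omega
          classical
          simp [Set.indicator_apply, hiff, hall l hl, hall l' hl']
        · simp [h.resolve_right hall, h'.resolve_right hall]
      intro x hx
      have := (hB.2.2 _ hd).2 j₀ hj₀ x hx
      by_contra hxq
      have hj₀ : j₀ ∉ B := hj₀
      simp [hjq, hj₀, hxq] at this
    have hmemB : ∀ x : Fin (s * m + k), x ∉ B ↔ s * a ≤ (x : ℕ) ∧ x < q := by
      intro x
      refine ⟨fun hx => ⟨hmin' x hx, hlt x hx⟩, fun ⟨h1, h2⟩ hx => ?_⟩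
      rcases eq_or_lt_of_le (show j₀ ≤ x from hj₀a.trans_le h1) with h | h
      · exact hj₀ (h ▸ hx)
      · exact absurd (hqmin x ⟨hx, h⟩) (not_le.2 h2)
    have hq0 : (j₀ : ℕ) < q := hjq
    have hqK := q.2
    obtain ⟨b, hbm, hqb, hb⟩ := hwin (j := ⟨q - 1, by omega⟩)
      ((hmemB _).2 ⟨by simp only; omega, by rw [Fin.lt_def]; simp only; omega⟩)
    rw [mem_window] at hqb
    simp only at hqb
    have hqeq : (q : ℕ) = s * b + k := by
      by_contra hne
      exact hb q ⟨by omega, by omega⟩ hqB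
    have hab : s * a ≤ s * b := by
      obtain ⟨h, hmem⟩ := hleft b (by omega)
      exact hmin' _ (hb _ hmem)
    rcases Nat.eq_zero_or_pos (s * a) with ha0 | ha0
    · have hbm' : b < m := by
        rcases (Nat.le_of_lt_succ hbm).lt_or_eq with h | rfl
        · exact h
        · omega
      refine ⟨.inr (.inl ⟨b, hbm'⟩), ?_⟩
      rw [← compl_inj_iff, compl_compl]
      ext x
      simp [facetComplement, hmemB, ha0, Fin.lt_def, hqeq]
    · exfalso
      have hd : {x : Fin (s * m + k) | (x : ℕ) < s * a}.indicator 1 ∈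
          constOnArgmax (m + 1) (window (s * m + k) k s) (B.indicator 1) := by
        intro i hi l hl l' hl'
        obtain ⟨hl, h⟩ := mem_argmaxOn_indicator.1 hl
        obtain ⟨hl', h'⟩ := mem_argmaxOn_indicator.1 hl'
        have hiff : (l : ℕ) < s * a ↔ (l' : ℕ) < s * a := by
          by_cases hall : ∀ j ∈ window (s * m + k) k s i, j ∉ B
          · have := hmin' l (hall l hl)
            have := hmin' l' (hall l' hl')
            omega
          · have h1 := (hmemB l).not.1 (not_not.2 (h.resolve_right hall))
            have h2 := (hmemB l').not.1 (not_not.2 (h'.resolve_right hall))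
            rw [mem_window] at hl hl'
            rw [Fin.lt_def] at h1 h2
            omega
        classical
        simp [Set.indicator_apply, hiff]
      have h0B : (⟨0, by omega⟩ : Fin (s * m + k)) ∈ B := by
        by_contra h
        have := hmin' _ h
        simp only at this
        omega
      have := (hB.2.2 _ hd).1 _ h0B q hqB
      have hqa : ¬ (q : ℕ) < s * a := by omega
      simp [ha0, hqa] at this
  · have hmemB : ∀ x : Fin (s * m + k), x ∉ B ↔ s * a ≤ (x : ℕ) := by
      refine fun x => ⟨hmin' x, fun h hx => ?_⟩
      rcases eq_or_lt_of_le (show j₀ ≤ x from hj₀a.trans_le h) with h | h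
      · exact hj₀ (h ▸ hx)
      · exact hq ⟨x, hx, h⟩
    have ha0 : a ≠ 0 := by
      rintro rfl
      obtain ⟨x, hx⟩ := hB.1
      exact (hmemB x).2 (by omega) hx
    obtain ⟨a, rfl⟩ := Nat.exists_eq_succ_of_ne_zero ha0
    refine ⟨.inr (.inr ⟨a, by omega⟩), ?_⟩
    rw [← compl_inj_iff, compl_compl]
    ext x
    simp [facetComplement, hmemB]

end Intervals

theorem poolPolytope_eq_windowSum (n k s : ℕ) :
    poolPolytope n k s = windowSum n (window (s * (n - 1) + k) k s) := by
  unfold poolPolytope windowSum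
  simp only [mem_window, and_assoc]

/-- for `k > s+1`, the polytope `P_{n,k,s}` has `(s+2)(n−1)+k` facets. -/
theorem card_facets_large_window (n k s : ℕ) (hn : 2 ≤ n) (hs : 0 < s) (hk : s + 1 < k) :
    Nat.card {F : Set (Fin (s * (n - 1) + k) → ℝ) // IsFacetOfPool n k s F} =
      (s + 2) * (n - 1) + k := by
  obtain ⟨m, rfl⟩ : ∃ m, n = m + 1 := ⟨n - 1, by omega⟩
  have : Nonempty (Fin (s * m + k)) := ⟨⟨0, by omega⟩⟩
  have hne : ∀ i < m + 1, (window (s * m + k) k s i).Nonempty :=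
    fun i hi => window_nonempty (by omega) hi
  have hconn := eq_of_mem_constOnArgmax_zero (m := m) hs hk
  have hiff : ∀ F, IsFacetOfPool (m + 1) k s F ↔
      ∃ B, IsFacetSupport (m + 1) (window (s * m + k) k s) B ∧
        F = maxFace (windowSum (m + 1) (window (s * m + k) k s)) (B.indicator 1) := by
    intro F
    rw [IsFacetOfPool, poolPolytope_eq_windowSum]
    exact isFacet_iff_exists_isFacetSupport hne hconn (by rw [Fintype.card_fin]; omega) F
  have hsupp := isFacetSupport_facetComplement_compl (m := m) hs hk
  have hbij : Function.Bijective (fun t =>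
      (⟨_, (hiff _).2 ⟨_, hsupp t, rfl⟩⟩ : {F // IsFacetOfPool (m + 1) k s F})) := by
    constructor
    · intro t t' h
      have := (hsupp t).eq_of_maxFace_eq hne hconn (hsupp t') (congrArg Subtype.val h)
      exact facetComplement_injective hs hk (compl_injective this)
    · rintro ⟨F, hF⟩
      obtain ⟨B, hB, rfl⟩ := (hiff F).1 hF
      obtain ⟨t, rfl⟩ := hB.exists_facetComplement (by omega)
      exact ⟨t, rfl⟩
  rw [← Nat.card_eq_of_bijective _ hbij]
  simp
  ring
end

section
/- Let k, s be positive integers with k ≤ 2s and s ≤ k−2. Then the sequence (1/n)·ln(b_n^{(k,s)}) converges as n → ∞, and its limit equals ln( 2(k−s)(k−s−1) / ( k − √(k² − 4(k−s)(k−s−1)) ) ). -/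
open Pointwise

/-- If each `x i` is the unique maximizer of `l` on `A i`, then `∑ i, x i` is an exposed point of
the Minkowski sum `∑ i, A i`, and it decomposes uniquely. -/
theorem sum_mem_exposedPoints_of_forall_maximizer {I E : Type*} [Fintype I] [AddCommGroup E]
    [Module ℝ E] [TopologicalSpace E] {A : I → Set E} {x : I → E} (l : StrongDual ℝ E)
    (hx : ∀ i, x i ∈ A i) (h : ∀ i, ∀ y ∈ A i, l y ≤ l (x i) ∧ (l (x i) ≤ l y → y = x i)) :
    (∑ i, x i ∈ (∑ i, A i).exposedPoints ℝ) ∧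
      ∀ y : I → E, (∀ i, y i ∈ A i) → ∑ i, y i = ∑ i, x i → y = x := by
  have key : ∀ y : I → E, (∀ i, y i ∈ A i) → l (∑ i, x i) ≤ l (∑ i, y i) → y = x := by
    intro y hy hle
    have hle' : ∀ i ∈ Finset.univ, l (y i) ≤ l (x i) := fun i _ => (h i _ (hy i)).1
    have heq : ∑ i, l (y i) = ∑ i, l (x i) :=
      le_antisymm (Finset.sum_le_sum hle') (by simpa only [map_sum] using hle)
    have := (Finset.sum_eq_sum_iff_of_le hle').1 heq
    exact funext fun i => (h i _ (hy i)).2 (this i (Finset.mem_univ i)).ge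
  refine ⟨⟨(Set.mem_fintype_sum _ _).2 ⟨x, hx, rfl⟩, l, fun z hz => ?_⟩, fun y hy hyx =>
    key y hy (by rw [hyx])⟩
  obtain ⟨y, hy, rfl⟩ := (Set.mem_fintype_sum _ _).1 hz
  refine ⟨?_, fun hle => by rw [key y hy hle]⟩
  rw [map_sum, map_sum]
  exact Finset.sum_le_sum fun i _ => (h i _ (hy i)).1

theorem forall_mem_convexHull_of_maximizer {E : Type*} [AddCommGroup E] [Module ℝ E]
    [TopologicalSpace E] {A : Set E} {x : E} (l : StrongDual ℝ E)
    (h : ∀ y ∈ A, y ≠ x → l y < l x) :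
    ∀ y ∈ convexHull ℝ A, l y ≤ l x ∧ (l x ≤ l y → y = x) := by
  have hconv : Convex ℝ {y : E | l y ≤ l x ∧ (l x ≤ l y → y = x)} := by
    intro y hy z hz a b ha hb hab
    simp only [Set.mem_ofPred_eq, map_add, map_smul, smul_eq_mul] at hy hz ⊢
    have h1 := mul_le_mul_of_nonneg_left hy.1 ha
    have h2 := mul_le_mul_of_nonneg_left hz.1 hb
    have h3 : a * l x + b * l x = l x := by rw [← add_mul, hab, one_mul]
    refine ⟨by linarith, fun hle => ?_⟩
    rcases ha.eq_or_lt with rfl | ha'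
    · obtain rfl : b = 1 := by linarith
      simpa using hz.2 (by linarith)
    rcases hb.eq_or_lt with rfl | hb'
    · obtain rfl : a = 1 := by linarith
      simpa using hy.2 (by linarith)
    rw [hy.2 (le_of_mul_le_mul_left (by linarith) ha'),
      hz.2 (le_of_mul_le_mul_left (by linarith) hb'), ← add_smul, hab, one_smul]
  refine fun y hy => convexHull_min (fun z hz => ?_) hconv hy
  by_cases hzx : z = x
  · simp [hzx]
  · exact ⟨(h z hz hzx).le, fun hle => absurd (h z hz hzx) hle.not_gt⟩

section SimplexSum

variable {I J : Type*} [Fintype I] [DecidableEq J]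

/-- A choice function `g` picking the `w`-heaviest element of each `S i` yields an extreme point of
the sum of the simplices spanned by the `S i`, and no other choice function yields this point. -/
theorem sum_single_mem_extremePoints [Fintype J] {S : I → Set J} {g : I → J} (w : J → ℝ)
    (hg : ∀ i, g i ∈ S i) (hw : ∀ i, ∀ j ∈ S i, j ≠ g i → w j < w (g i)) :
    (∑ i, Pi.single (g i) (1 : ℝ) ∈ Set.extremePoints ℝ
      (∑ i, convexHull ℝ ((fun j => (Pi.single j 1 : J → ℝ)) '' S i))) ∧
    ∀ g' : I → J, (∀ i, g' i ∈ S i) →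
      ∑ i, (Pi.single (g' i) 1 : J → ℝ) = ∑ i, Pi.single (g i) 1 → g' = g := by
  let l : StrongDual ℝ (J → ℝ) := ∑ j, w j • ContinuousLinearMap.proj (R := ℝ) (φ := fun _ => ℝ) j
  have hl : ∀ j, l (Pi.single j 1) = w j := by
    intro j
    simp [l, Pi.single_apply]
  have hmem : ∀ g' : I → J, (∀ i, g' i ∈ S i) → ∀ i, (Pi.single (g' i) 1 : J → ℝ) ∈
      convexHull ℝ ((fun j => (Pi.single j 1 : J → ℝ)) '' S i) :=
    fun g' hg' i => subset_convexHull ℝ _ ⟨g' i, hg' i, rfl⟩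
  obtain ⟨h1, h2⟩ := sum_mem_exposedPoints_of_forall_maximizer l (hmem g hg) fun i => by
    apply forall_mem_convexHull_of_maximizer
    rintro _ ⟨j, hj, rfl⟩ hne
    simp only [hl]
    exact hw i j hj fun h => hne (by rw [h])
  refine ⟨exposedPoints_subset_extremePoints h1, fun g' hg' heq => funext fun i => ?_⟩
  have := congrFun (congrFun (h2 _ (hmem g' hg') heq) i) (g' i)
  by_contra hne
  simp [hne] at this

theorem exists_eq_sum_single_of_mem_extremePoints {S : I → Set J} {x : J → ℝ}
    (hx : x ∈ Set.extremePoints ℝ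
      (∑ i, convexHull ℝ ((fun j => (Pi.single j 1 : J → ℝ)) '' S i))) :
    ∃ g : I → J, (∀ i, g i ∈ S i) ∧ ∑ i, Pi.single (g i) 1 = x ∧
      ∀ i j, g i ∈ S j → g j ∈ S i → g i = g j := by
  classical
  have hx' := hx
  rw [← convexHull_sum] at hx'
  obtain ⟨y, hy, rfl⟩ := (Set.mem_fintype_sum _ _).1 (extremePoints_convexHull_subset hx')
  choose g hg hgy using hy
  obtain rfl : (fun i => Pi.single (g i) 1) = y := funext hgy
  refine ⟨g, hg, rfl, fun i j hij hji => ?_⟩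
  by_contra hne
  have hupd : ∀ i j, g j ∈ S i →
      ∑ l, (Pi.single (Function.update g i (g j) l) 1 : J → ℝ) ∈
        ∑ i, convexHull ℝ ((fun j => (Pi.single j 1 : J → ℝ)) '' S i) := by
    intro i j hji
    refine (Set.mem_fintype_sum _ _).2 ⟨_, fun l => subset_convexHull ℝ _ ⟨_, ?_, rfl⟩, rfl⟩
    rcases eq_or_ne l i with rfl | hl
    · simpa using hji
    · simpa [hl] using hg l
  have hsum : ∀ i j, ∑ l, (Pi.single (Function.update g i (g j) l) 1 : J → ℝ) =
      ∑ l, Pi.single (g l) 1 + Pi.single (g j) 1 - Pi.single (g i) 1 := by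
    intro i j
    have h1 := Finset.sum_update_of_mem (Finset.mem_univ i)
      (fun l => (Pi.single (g l) 1 : J → ℝ)) (Pi.single (g j) 1)
    have h2 := Finset.sum_update_of_mem (Finset.mem_univ i)
      (fun l => (Pi.single (g l) 1 : J → ℝ)) (Pi.single (g i) 1)
    rw [Function.update_eq_self] at h2
    have h3 : ∀ l, (Pi.single (Function.update g i (g j) l) 1 : J → ℝ) =
        Function.update (fun l => (Pi.single (g l) 1 : J → ℝ)) i (Pi.single (g j) 1) l := by
      intro l
      rcases eq_or_ne l i with rfl | hl
      · simp
      · simp [hl]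
    rw [Finset.sum_congr rfl fun l _ => h3 l, h1, h2]
    abel
  have := ((mem_extremePoints.1 hx).2 _ (hupd i j hji) _ (hupd j i hij) ?_).1
  · rw [hsum, add_sub_assoc, add_eq_left] at this
    have := congrFun this (g i)
    simp [hne] at this
  · refine ⟨1 / 2, 1 / 2, by norm_num, by norm_num, by norm_num, ?_⟩
    rw [hsum, hsum]
    module

end SimplexSum

/-- When each window `[s i, s i + k)` meets only its neighbours, a choice of one point `p i` in each
window in which neighbours never pick two different common points is induced by a weight. -/
theorem exists_weight_of_compatible {n k s : ℕ} (hks : k ≤ 2 * s) {p : ℕ → ℕ}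
    (hp : ∀ i < n, s * i ≤ p i ∧ p i < s * i + k)
    (hc : ∀ i, i + 1 < n → p i < s * (i + 1) ∨ s * i + k ≤ p (i + 1) ∨ p i = p (i + 1)) :
    ∃ w : ℕ → ℝ, ∀ i < n, ∀ j, s * i ≤ j → j < s * i + k → j ≠ p i → w j < w (p i) := by
  classical
  let u : ℕ → ℤ := fun i => ∑ l ∈ Finset.range i,
    if p l = p (l + 1) then 0 else if s * (l + 1) ≤ p l then 1 else -1
  have hu : ∀ i, u (i + 1) = u i +
      if p i = p (i + 1) then 0 else if s * (i + 1) ≤ p i then 1 else -1 :=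
    fun i => Finset.sum_range_succ _ i
  have hlow : ∀ i : ℕ, -(i : ℤ) ≤ u i := by
    intro i
    induction i with
    | zero => simp [u]
    | succ i ih =>
      rw [hu]
      push_cast
      split_ifs <;> omega
  have hnear : ∀ i i' j, s * i ≤ j → j < s * i' + k → i ≤ i' + 1 := by
    intro i i' j h1 h2
    have : s * i < s * (i' + 2) := by rw [mul_add]; omega
    have := Nat.lt_of_mul_lt_mul_left this
    omega
  have hsame : ∀ i < n, ∀ i' < n, p i = p i' → u i = u i' := by
    intro i hi i' hi' h
    have h1 := hnear i i' (p i) (hp i hi).1 (h ▸ (hp i' hi').2)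
    have h2 := hnear i' i (p i') (hp i' hi').1 (h ▸ (hp i hi).2)
    obtain rfl | rfl | rfl : i = i' ∨ i = i' + 1 ∨ i' = i + 1 := by omega
    · rfl
    · rw [hu, if_pos h.symm, add_zero]
    · rw [hu, if_pos h, add_zero]
  let w : ℕ → ℤ := fun j => if h : ∃ i, i < n ∧ p i = j then u h.choose + n + 1 else 0
  have hw : ∀ i < n, w (p i) = u i + n + 1 := by
    intro i hi
    have h : ∃ i', i' < n ∧ p i' = p i := ⟨i, hi, rfl⟩
    simp only [w, dif_pos h]
    rw [hsame _ h.choose_spec.1 i hi h.choose_spec.2]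
  refine ⟨fun j => w j, fun i hi j h1 h2 hne => Int.cast_lt.2 ?_⟩
  by_cases h : ∃ i', i' < n ∧ p i' = j
  · obtain ⟨i', hi', rfl⟩ := h
    rw [hw i hi, hw i' hi']
    have h3 := hnear i i' (p i') h1 (hp i' hi').2
    have h4 := hnear i' i (p i') (hp i' hi').1 h2
    obtain rfl | rfl | rfl : i = i' ∨ i = i' + 1 ∨ i' = i + 1 := by omega
    · exact absurd rfl hne
    · rw [hu, if_neg hne, if_pos h1]
      omega
    · have := hc i hi'
      rw [hu, if_neg hne.symm, if_neg (by omega)]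
      omega
  · have := hlow i
    rw [hw i hi]
    simp only [w, dif_neg h]
    omega

/-- Choosing the points at offsets `a` and `b` in two consecutive windows of length `k` and stride
`s` is compatible: the two points coincide or are not both common to the two windows. -/
def OffsetCompatible (k s : ℕ) (a b : Fin k) : Prop :=
  (a : ℕ) < s ∨ k ≤ s + b ∨ (a : ℕ) = s + b

/-- The words of length `n` all of whose consecutive letters are related by `r`. -/
def RelWord {α : Type*} (r : α → α → Prop) (n : ℕ) : Type _ :=
  {g : Fin n → α // ∀ i j : Fin n, (j : ℕ) = i + 1 → r (g i) (g j)}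

/-- The polytope as a sum over `Fin n` of hulls of images of windows. -/
theorem poolPolytope_eq_sum (n k s : ℕ) : poolPolytope n k s =
    ∑ i : Fin n, convexHull ℝ ((fun j => (Pi.single j 1 : Fin (s * (n - 1) + k) → ℝ)) ''
      {j | s * i ≤ (j : ℕ) ∧ (j : ℕ) < s * i + k}) := by
  rw [poolPolytope, Finset.sum_range]
  refine Finset.sum_congr rfl fun i _ => congrArg _ (Set.ext fun v => ?_)
  constructor
  · rintro ⟨j, h1, h2, rfl⟩
    exact ⟨j, ⟨h1, h2⟩, rfl⟩
  · rintro ⟨j, ⟨h1, h2⟩, rfl⟩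
    exact ⟨j, h1, h2, rfl⟩

/-- Vertices correspond to words of compatible offsets. -/
theorem numVertices_eq_card_relWord {n k s : ℕ} (hks : k ≤ 2 * s) :
    numVertices n k s = Nat.card (RelWord (OffsetCompatible k s) n) := by
  have hpos : ∀ (i : Fin n) (a : Fin k), s * i + a < s * (n - 1) + k := by
    intro i a
    have : s * i ≤ s * (n - 1) := Nat.mul_le_mul_left s (by omega)
    omega
  let pos : (Fin n → Fin k) → Fin n → Fin (s * (n - 1) + k) := fun g i => ⟨s * i + g i, hpos i _⟩
  have hmem : ∀ (g : Fin n → Fin k) (i : Fin n),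
      pos g i ∈ {j : Fin (s * (n - 1) + k) | s * i ≤ (j : ℕ) ∧ (j : ℕ) < s * i + k} :=
    fun g i => ⟨Nat.le_add_right _ _, Nat.add_lt_add_left (g i).2 _⟩
  have hinj : Function.Injective pos := by
    intro g g' h
    funext i
    have := congrArg Fin.val (congrFun h i)
    simp only [pos] at this
    exact Fin.ext (by omega)
  have hext : ∀ g : RelWord (OffsetCompatible k s) n,
      (∑ i, Pi.single (pos g.1 i) (1 : ℝ) ∈ Set.extremePoints ℝ (poolPolytope n k s)) ∧
      ∀ g' : Fin n → Fin k, ∑ i, (Pi.single (pos g' i) 1 : Fin (s * (n - 1) + k) → ℝ) =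
        ∑ i, Pi.single (pos g.1 i) 1 → g' = g.1 := by
    intro g
    let p : ℕ → ℕ := fun i => if h : i < n then s * i + g.1 ⟨i, h⟩ else 0
    have hp : ∀ i (h : i < n), p i = s * i + g.1 ⟨i, h⟩ := fun i h => dif_pos h
    obtain ⟨w, hw⟩ := exists_weight_of_compatible hks (n := n) (p := p)
      (fun i hi => by rw [hp i hi]; exact ⟨by omega, by omega⟩) (fun i hi => by
        rw [hp i (by omega), hp (i + 1) hi, mul_add]
        have := g.2 ⟨i, by omega⟩ ⟨i + 1, hi⟩ rfl
        unfold OffsetCompatible at this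
        omega)
    have := sum_single_mem_extremePoints (g := pos g.1) (S := fun i : Fin n =>
        {j : Fin (s * (n - 1) + k) | s * i ≤ (j : ℕ) ∧ (j : ℕ) < s * i + k})
      (fun j => w j) (hmem g.1) fun i j hj hne => by
      have h := hw i i.2 j hj.1 hj.2 fun h => hne (Fin.ext (h.trans (hp i i.2)))
      rwa [hp i i.2] at h
    rw [poolPolytope_eq_sum]
    exact ⟨this.1, fun g' h => hinj (this.2 _ (hmem g') h)⟩
  refine (Nat.card_congr (Equiv.ofBijective
    (fun g : RelWord (OffsetCompatible k s) n => ⟨_, (hext g).1⟩) ⟨?_, ?_⟩)).symm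
  · intro g g' h
    exact Subtype.ext ((hext g').2 _ (congrArg Subtype.val h))
  · rintro ⟨x, hx⟩
    rw [poolPolytope_eq_sum] at hx
    obtain ⟨f, hf, rfl, hcomp⟩ := exists_eq_sum_single_of_mem_extremePoints hx
    let g : Fin n → Fin k := fun i => ⟨f i - s * i, by have := hf i; simp at this; omega⟩
    have hval : ∀ i, (f i : ℕ) = s * i + g i := fun i => by
      have := hf i
      simp only [g]
      simp at this
      omega
    have hgf : pos g = f := funext fun i => Fin.ext (hval i).symm
    refine ⟨⟨g, fun i j hij => ?_⟩, Subtype.ext (by simp only [hgf])⟩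
    have h := hcomp i j
    have h1 := hval i
    have h2 := hval j
    simp only [Set.mem_ofPred_eq, Fin.ext_iff] at h
    rw [hij, mul_add] at h h2
    unfold OffsetCompatible
    omega

section Counting

variable {α : Type*} (r : α → α → Prop)

/-- The number of words of length `n` that can follow the letter `a`. -/
noncomputable def followCount (n : ℕ) (a : α) : ℕ :=
  Nat.card {g : RelWord r n // ∀ h : 0 < n, r a (g.1 ⟨0, h⟩)}

/-- Splitting off the first letter. -/
def relWordSuccEquiv (n : ℕ) :
    RelWord r (n + 1) ≃ Σ a, {g : RelWord r n // ∀ h : 0 < n, r a (g.1 ⟨0, h⟩)} where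
  toFun g := ⟨g.1 0, ⟨⟨fun i => g.1 i.succ, fun i j hij => g.2 _ _ (by simp [hij])⟩,
    fun h => g.2 _ _ (by simp)⟩⟩
  invFun g := ⟨Fin.cons g.1 g.2.1.1, fun i j => by
    refine Fin.cases ?_ (fun j hij => ?_) j
    · intro h
      simp at h
    revert hij
    refine Fin.cases (fun hij => ?_) (fun i hij => ?_) i
    · have : j = ⟨0, j.pos⟩ := Fin.ext (by simpa using hij)
      rw [this]
      exact g.2.2 _
    · simp only [Fin.cons_succ]
      exact g.2.1.2 _ _ (by simpa using hij)⟩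
  left_inv g := Subtype.ext (Fin.cons_self_tail g.1)
  right_inv _ := rfl

instance [Finite α] (n : ℕ) : Finite (RelWord r n) := inferInstanceAs (Finite (Subtype _))

theorem card_relWord_zero : Nat.card (RelWord r 0) = 1 := by
  have : Unique (RelWord r 0) :=
    { default := ⟨Fin.elim0, fun i => i.elim0⟩
      uniq := fun g => Subtype.ext (Subsingleton.elim _ _) }
  exact Nat.card_unique

theorem followCount_zero (a : α) : followCount r 0 a = 1 := by
  rw [← card_relWord_zero r]
  exact Nat.card_congr (Equiv.subtypeUnivEquiv fun g h => absurd h (lt_irrefl _))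

variable [Fintype α]

theorem card_relWord_succ (n : ℕ) :
    Nat.card (RelWord r (n + 1)) = ∑ a, followCount r n a := by
  rw [Nat.card_congr (relWordSuccEquiv r n), Nat.card_sigma]
  rfl

theorem followCount_succ [DecidableRel r] (n : ℕ) (a : α) :
    followCount r (n + 1) a = ∑ b with r a b, followCount r n b := by
  have e : {g : RelWord r (n + 1) // ∀ h : 0 < n + 1, r a (g.1 ⟨0, h⟩)} ≃
      {x : Σ b, {g : RelWord r n // ∀ h : 0 < n, r b (g.1 ⟨0, h⟩)} // r a x.1} :=
    (relWordSuccEquiv r n).subtypeEquiv fun g => ⟨fun h => h n.succ_pos, fun h _ => h⟩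
  rw [followCount, Nat.card_congr (e.trans (Equiv.subtypeSigmaEquiv _ _)), Nat.card_sigma,
    Finset.sum_subtype (p := r a) _ (by simp)]
  rfl

end Counting

/-- The two-step recursion for the number of words of compatible offsets. -/
theorem card_relWord_offsetCompatible_add_two {k s : ℕ} (hks : k ≤ 2 * s) (hsk : s < k) (n : ℕ) :
    (Nat.card (RelWord (OffsetCompatible k s) (n + 2)) : ℝ) =
      k * Nat.card (RelWord (OffsetCompatible k s) (n + 1)) -
        ((k : ℝ) - s) * (k - s - 1) * Nat.card (RelWord (OffsetCompatible k s) n) := by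
  classical
  let t : ℕ → ℕ := fun n => Nat.card (RelWord (OffsetCompatible k s) n)
  let c : ℕ → Fin k → ℕ := followCount (OffsetCompatible k s)
  have hcs : ∀ n (a : Fin k), c (n + 1) a = ∑ b with OffsetCompatible k s a b, c n b :=
    followCount_succ _
  have hts : ∀ n, t (n + 1) = ∑ a, c n a := card_relWord_succ _
  have hlow : ∀ n (a : Fin k), (a : ℕ) < s → c n a = t n := by
    intro n a ha
    cases n with
    | zero => exact (followCount_zero _ a).trans (card_relWord_zero _).symm
    | succ n =>
      have : ∀ b ∈ Finset.univ, OffsetCompatible k s a b := fun b _ => Or.inl ha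
      rw [hcs, hts, Finset.filter_true_of_mem this]
  have hhigh : ∀ n (a : Fin k), s ≤ (a : ℕ) → c (n + 1) a + (k - s - 1) * t n = t (n + 1) := by
    intro n a ha
    rw [hcs, hts, ← Finset.sum_filter_add_sum_filter_not Finset.univ (OffsetCompatible k s a)]
    congr 1
    have hcard : (Finset.univ.filter fun b => ¬ OffsetCompatible k s a b).card = k - s - 1 := by
      have : (Finset.univ.filter fun b => ¬ OffsetCompatible k s a b) =
          (Finset.univ.filter fun b : Fin k => (b : ℕ) < k - s).erase ⟨a - s, by omega⟩ := by
        ext b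
        simp only [Finset.mem_filter, Finset.mem_univ, true_and, Finset.mem_erase, ne_eq,
          Fin.ext_iff]
        unfold OffsetCompatible
        omega
      rw [this, Finset.card_erase_of_mem (by simp; omega), Fin.card_filter_val_lt]
      congr 1
      omega
    rw [← hcard, ← smul_eq_mul, ← Finset.sum_const]
    refine Finset.sum_congr rfl fun b hb => (hlow n b ?_).symm
    simp only [Finset.mem_filter, Finset.mem_univ, true_and] at hb
    unfold OffsetCompatible at hb
    omega
  have hsum : (t (n + 2) : ℝ) = ∑ a : Fin k,
      ((t (n + 1) : ℝ) - if (a : ℕ) < s then 0 else ((k : ℝ) - s - 1) * t n) := by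
    rw [hts (n + 1), Nat.cast_sum]
    refine Finset.sum_congr rfl fun a _ => ?_
    split_ifs with ha
    · rw [hlow _ a ha, sub_zero]
    · rw [← hhigh n a (not_lt.1 ha)]
      push_cast [show 1 ≤ k - s by omega, hsk.le]
      ring
  have hcard : (Finset.univ.filter fun a : Fin k => ¬ (a : ℕ) < s).card = k - s := by
    rw [Finset.filter_not, Finset.card_sdiff_of_subset (Finset.filter_subset _ _),
      Fin.card_filter_val_lt, Finset.card_univ, Fintype.card_fin]
    omega
  rw [Finset.sum_sub_distrib, Finset.sum_ite, Finset.sum_const_zero, Finset.sum_const,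
    Finset.sum_const, hcard, Finset.card_univ, Fintype.card_fin, zero_add, nsmul_eq_mul,
    nsmul_eq_mul, Nat.cast_sub hsk.le] at hsum
  exact hsum.trans (by ring)

theorem card_relWord_one {α : Type*} (r : α → α → Prop) [Fintype α] :
    Nat.card (RelWord r 1) = Fintype.card α := by
  simp [card_relWord_succ, followCount_zero]

/-- Exponential growth rate of a solution of a second-order linear recursion whose characteristic
roots `x ≥ y ≥ 0` satisfy `0 < x`. -/
theorem tendsto_log_div_of_recursion {t : ℕ → ℝ} {x y : ℝ} (hx : 0 < x) (hy : 0 ≤ y) (hyx : y ≤ x)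
    (h0 : t 0 = 1) (h1 : t 1 = x + y) (ht : ∀ n, t (n + 2) = (x + y) * t (n + 1) - x * y * t n) :
    Filter.Tendsto (fun n : ℕ => (1 / (n : ℝ)) * Real.log (t n)) Filter.atTop
      (nhds (Real.log x)) := by
  have hstep : ∀ n, t (n + 1) = x * t n + y ^ (n + 1) := by
    intro n
    induction n with
    | zero => simp [h0, h1]
    | succ n ih =>
      rw [ht, pow_succ]
      linear_combination y * ih
  have hlow : ∀ n, x ^ n ≤ t n := by
    intro n
    induction n with
    | zero => simp [h0]
    | succ n ih =>
      rw [hstep, pow_succ']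
      have := mul_le_mul_of_nonneg_left ih hx.le
      have := pow_nonneg hy (n + 1)
      linarith
  have hupp : ∀ n : ℕ, t n ≤ (n + 1) * x ^ n := by
    intro n
    induction n with
    | zero => simp [h0]
    | succ n ih =>
      rw [hstep]
      have h2 := mul_le_mul_of_nonneg_left ih hx.le
      have h3 := pow_le_pow_left₀ hy hyx (n + 1)
      rw [pow_succ' x] at h3 ⊢
      push_cast
      linarith
  have hlim : Filter.Tendsto (fun n : ℕ => (1 / (n : ℝ)) * Real.log (n + 1) + Real.log x)
      Filter.atTop (nhds (Real.log x)) := by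
    have hlog : Filter.Tendsto (fun z : ℝ => Real.log z / z) Filter.atTop (nhds 0) :=
      Real.isLittleO_log_id_atTop.tendsto_div_nhds_zero
    have h2 := hlog.comp
      (Filter.tendsto_atTop_add_const_right _ (1 : ℝ) tendsto_natCast_atTop_atTop)
    have h3 : Filter.Tendsto (fun n : ℕ => ((n : ℝ) + 1) / n) Filter.atTop (nhds 1) := by
      have := (tendsto_const_nhds (x := (1 : ℝ))).add (tendsto_one_div_atTop_nhds_zero_nat (𝕜 := ℝ))
      rw [add_zero] at this
      refine this.congr' ?_
      filter_upwards [Filter.eventually_gt_atTop 0] with n hn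
      have : (n : ℝ) ≠ 0 := by positivity
      field_simp
    have h4 := (h2.mul h3).add_const (Real.log x)
    rw [zero_mul, zero_add] at h4
    refine h4.congr fun n => ?_
    have : (n : ℝ) + 1 ≠ 0 := by positivity
    simp only [Function.comp_apply]
    field_simp
  refine tendsto_of_tendsto_of_tendsto_of_le_of_le' tendsto_const_nhds hlim ?_ ?_
  · filter_upwards [Filter.eventually_gt_atTop 0] with n hn
    have hn' : (n : ℝ) ≠ 0 := by positivity
    have := Real.log_le_log (pow_pos hx n) (hlow n)
    rw [Real.log_pow] at this
    calc Real.log x = 1 / (n : ℝ) * (n * Real.log x) := by field_simp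
      _ ≤ _ := by gcongr
  · filter_upwards [Filter.eventually_gt_atTop 0] with n hn
    have hn' : (n : ℝ) ≠ 0 := by positivity
    have := Real.log_le_log ((pow_pos hx n).trans_le (hlow n)) (hupp n)
    rw [Real.log_mul (by positivity) (by positivity), Real.log_pow] at this
    calc _ ≤ 1 / (n : ℝ) * (Real.log (n + 1) + n * Real.log x) := by gcongr
      _ = _ := by field_simp

/-- large strides `⌈k/2⌉ ≤ s ≤ k−2`: the exponential growth rate of the
number of vertices `b_n^{(k,s)}`. -/
theorem numVertices_asymptotics_large_strides (k s : ℕ) (hk : 0 < k) (hs : 0 < s)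
    (h1 : k ≤ 2 * s) (h2 : s ≤ k - 2) :
    Filter.Tendsto
      (fun n : ℕ => (1 / (n : ℝ)) * Real.log (numVertices n k s))
      Filter.atTop
      (nhds (Real.log
        (2 * ((k : ℝ) - s) * ((k : ℝ) - s - 1) /
          ((k : ℝ) - Real.sqrt ((k : ℝ) ^ 2 - 4 * ((k : ℝ) - s) * ((k : ℝ) - s - 1)))))) := by
  set d : ℝ := Real.sqrt ((k : ℝ) ^ 2 - 4 * ((k : ℝ) - s) * ((k : ℝ) - s - 1)) with hd
  have hs2 : (s : ℝ) + 2 ≤ k := by exact_mod_cast (by omega : s + 2 ≤ k)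
  have hk2 : (k : ℝ) ≤ 2 * s := by exact_mod_cast h1
  have hprod : 0 < ((k : ℝ) - s) * (k - s - 1) := mul_pos (by linarith) (by linarith)
  have hsq : d ^ 2 = (k : ℝ) ^ 2 - 4 * ((k : ℝ) - s) * ((k : ℝ) - s - 1) :=
    Real.sq_sqrt (by nlinarith)
  have hd0 : 0 ≤ d := Real.sqrt_nonneg _
  have hdk : d < k := lt_of_pow_lt_pow_left₀ 2 (by positivity) (by linarith)
  have hlim : 2 * ((k : ℝ) - s) * (k - s - 1) / (k - d) = (k + d) / 2 := by
    rw [div_eq_div_iff (by linarith) two_ne_zero]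
    linear_combination hsq
  rw [hlim]
  have hxy : (k + d) / 2 * ((k - d) / 2) = ((k : ℝ) - s) * (k - s - 1) := by
    linear_combination -hsq / 4
  have := tendsto_log_div_of_recursion
    (t := fun n => (Nat.card (RelWord (OffsetCompatible k s) n) : ℝ))
    (x := (k + d) / 2) (y := (k - d) / 2) (by linarith) (by linarith) (by linarith)
    (by simp [card_relWord_zero]) (by simp only [card_relWord_one, Fintype.card_fin]; ring) fun n => by
      rw [card_relWord_offsetCompatible_add_two h1 (by omega), hxy]
      ring
  simpa only [numVertices_eq_card_relWord h1] using this
end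

section
/- The numbers of vertices V_n of the polytopes Q_n satisfy the linear recurrence V_{n+4} = 13·V_{n+3} − 31·V_{n+2} + 20·V_{n+1} − 4·V_n for all n ≥ 2, with initial values V_2 = 14, V_3 = 150, V_4 = 1536 and V_5 = 15594. -/
open Pointwise

/-- The polytope `Q_n ⊆ ℝ^{3×n}`: the Minkowski sum of the `2(n−1)` simplices
`Δ_{i,j} = conv{e_{i,j}, e_{i,j+1}, e_{i+1,j}, e_{i+1,j+1}}` for `0 ≤ i ≤ 1`, `0 ≤ j ≤ n−2`. -/
noncomputable def Qpolytope (n : ℕ) : Set (Fin 3 × Fin n → ℝ) :=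
  ∑ i : Fin 2, ∑ j : Fin (n - 1),
    convexHull ℝ
      ({Pi.single (Fin.castSucc i, ⟨j.1, by have := j.isLt; omega⟩) (1 : ℝ),
        Pi.single (Fin.castSucc i, ⟨j.1 + 1, by have := j.isLt; omega⟩) (1 : ℝ),
        Pi.single (Fin.succ i, ⟨j.1, by have := j.isLt; omega⟩) (1 : ℝ),
        Pi.single (Fin.succ i, ⟨j.1 + 1, by have := j.isLt; omega⟩) (1 : ℝ)} :
        Set (Fin 3 × Fin n → ℝ))

/-- `V_n`, the number of vertices (extreme points) of `Q_n`. -/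
noncomputable def numVerticesQ (n : ℕ) : ℕ :=
  Nat.card (Set.extremePoints ℝ (Qpolytope n))

/-- The Minkowski sum over `i` of the simplices spanned by the basis vectors `e_{vtx i p}`. -/
def simplexSum {ι P κ : Type*} [Fintype ι] [DecidableEq κ] (vtx : ι → P → κ) : Set (κ → ℝ) :=
  ∑ i, convexHull ℝ (Set.range fun p => Pi.single (vtx i p) (1 : ℝ))

/-- The sum of the vertices chosen by `c`, one from each simplex. -/
noncomputable def selectionPoint {ι P κ : Type*} [Fintype ι] [DecidableEq κ]
    (vtx : ι → P → κ) (c : ι → P) : κ → ℝ :=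
  ∑ i, Pi.single (vtx i (c i)) (1 : ℝ)

/-- A choice of one vertex in each simplex is realizable if some weight is, on each simplex,
maximized exactly at the chosen vertex. -/
def IsRealizable {ι P κ : Type*} (vtx : ι → P → κ) (c : ι → P) : Prop :=
  ∃ w : κ → ℝ, ∀ i p, p ≠ c i → w (vtx i p) < w (vtx i (c i))

theorem convex_setOf_dotProduct_lt_or_eq {κ : Type*} [Fintype κ] (w v : κ → ℝ) :
    Convex ℝ {x | w ⬝ᵥ x < w ⬝ᵥ v ∨ x = v} := by
  intro x hx y hy a b ha hb hab
  rcases ha.eq_or_lt with rfl | ha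
  · obtain rfl : b = 1 := by linarith
    simpa using hy
  rcases hb.eq_or_lt with rfl | hb
  · obtain rfl : a = 1 := by linarith
    simpa using hx
  have hb' : b = 1 - a := by linarith
  rcases hx with hx | rfl <;> rcases hy with hy | rfl
  · left
    simp only [dotProduct_add, dotProduct_smul, smul_eq_mul]
    subst hb'
    nlinarith
  · left
    simp only [dotProduct_add, dotProduct_smul, smul_eq_mul]
    subst hb'
    nlinarith
  · left
    simp only [dotProduct_add, dotProduct_smul, smul_eq_mul]
    subst hb'
    nlinarith
  · right
    rw [← add_smul, hab, one_smul]

theorem mem_extremePoints_of_dotProduct_lt {κ : Type*} [Fintype κ] {A : Set (κ → ℝ)}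
    {w v : κ → ℝ} (hv : v ∈ A) (h : ∀ x ∈ A, w ⬝ᵥ x < w ⬝ᵥ v ∨ x = v) :
    v ∈ A.extremePoints ℝ := by
  refine mem_extremePoints_iff_left.2 ⟨hv, ?_⟩
  rintro x hx y hy ⟨a, b, ha, hb, hab, hxy⟩
  refine (h x hx).resolve_left fun hlt => ?_
  have hy' : w ⬝ᵥ y ≤ w ⬝ᵥ v := by
    rcases h y hy with h | rfl
    exacts [h.le, le_rfl]
  have := congrArg (w ⬝ᵥ ·) hxy
  simp only [dotProduct_add, dotProduct_smul, smul_eq_mul] at this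
  obtain rfl : b = 1 - a := by linarith
  nlinarith

section Vertices

variable {ι P κ : Type*} [Fintype ι] [DecidableEq κ] {vtx : ι → P → κ}

theorem selectionPoint_mem_simplexSum (c : ι → P) :
    selectionPoint vtx c ∈ simplexSum vtx :=
  Set.finsetSum_mem_finsetSum _ _ _ fun i _ => subset_convexHull ℝ _ ⟨c i, rfl⟩

theorem exists_eq_selectionPoint {v : κ → ℝ} (hv : v ∈ (simplexSum vtx).extremePoints ℝ) :
    ∃ c : ι → P, v = selectionPoint vtx c := by
  rw [simplexSum, ← convexHull_sum] at hv
  obtain ⟨g, hg, rfl⟩ := (Set.mem_finsetSum _ _ _).1 (extremePoints_convexHull_subset hv)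
  choose c hc using fun i => hg (Finset.mem_univ i)
  exact ⟨c, Finset.sum_congr rfl fun i _ => (hc i).symm⟩

variable [Fintype κ]

theorem dotProduct_lt_or_eq_selectionPoint {c : ι → P} {w : κ → ℝ}
    (hw : ∀ i p, p ≠ c i → w (vtx i p) < w (vtx i (c i))) {x : κ → ℝ}
    (hx : x ∈ simplexSum vtx) :
    w ⬝ᵥ x < w ⬝ᵥ selectionPoint vtx c ∨ x = selectionPoint vtx c := by
  obtain ⟨g, hg, rfl⟩ := (Set.mem_finsetSum _ _ _).1 hx
  have key : ∀ i, w ⬝ᵥ g i < w ⬝ᵥ Pi.single (vtx i (c i)) (1 : ℝ) ∨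
      g i = Pi.single (vtx i (c i)) (1 : ℝ) := by
    intro i
    refine convexHull_min ?_ (convex_setOf_dotProduct_lt_or_eq w _) (hg (Finset.mem_univ i))
    rintro _ ⟨p, rfl⟩
    by_cases hp : p = c i
    · exact Or.inr (by simp [hp])
    · exact Or.inl (by simpa using hw i p hp)
  by_cases hall : ∀ i, g i = Pi.single (vtx i (c i)) (1 : ℝ)
  · exact Or.inr (Finset.sum_congr rfl fun i _ => hall i)
  · push Not at hall
    obtain ⟨i, hi⟩ := hall
    left
    simp only [selectionPoint, dotProduct_sum]
    refine Finset.sum_lt_sum (fun j _ => ?_) ⟨i, Finset.mem_univ i, (key i).resolve_right hi⟩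
    rcases key j with h | h
    exacts [h.le, h ▸ le_rfl]

theorem IsRealizable.selectionPoint_mem_extremePoints {c : ι → P} (hc : IsRealizable vtx c) :
    selectionPoint vtx c ∈ (simplexSum vtx).extremePoints ℝ := by
  obtain ⟨w, hw⟩ := hc
  exact mem_extremePoints_of_dotProduct_lt (selectionPoint_mem_simplexSum c)
    fun x hx => dotProduct_lt_or_eq_selectionPoint hw hx

theorem IsRealizable.eq_of_selectionPoint_eq {c d : ι → P} (hc : IsRealizable vtx c)
    (h : selectionPoint vtx c = selectionPoint vtx d) : c = d := by
  obtain ⟨w, hw⟩ := hc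
  by_contra hne
  obtain ⟨i, hi⟩ := Function.ne_iff.1 hne
  have hlt : w ⬝ᵥ selectionPoint vtx d < w ⬝ᵥ selectionPoint vtx c := by
    simp only [selectionPoint, dotProduct_sum, dotProduct_single, mul_one]
    refine Finset.sum_lt_sum (fun j _ => ?_) ⟨i, Finset.mem_univ i, hw i _ (Ne.symm hi)⟩
    by_cases hj : d j = c j
    · rw [hj]
    · exact (hw j _ hj).le
  exact hlt.ne (by rw [h])

end Vertices

theorem selectionPoint_update {ι P κ : Type*} [Fintype ι] [DecidableEq ι] [DecidableEq κ]
    (vtx : ι → P → κ) (c : ι → P) (i : ι) (p : P) :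
    selectionPoint vtx (Function.update c i p) =
      selectionPoint vtx c + (Pi.single (vtx i p) 1 - Pi.single (vtx i (c i)) 1) := by
  rw [← sub_eq_iff_eq_add', selectionPoint, selectionPoint, ← Finset.sum_sub_distrib,
    Finset.sum_eq_single i]
  · simp
  · intro j _ hj
    simp [Function.update_of_ne hj]
  · simp

/-- An extreme point of a sum of simplices arises from only one choice of vertices. -/
theorem eq_of_selectionPoint_mem_extremePoints {ι P κ : Type*} [Fintype ι] [DecidableEq κ]
    {vtx : ι → P → κ} (hinj : ∀ i, Function.Injective (vtx i)) {c d : ι → P}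
    (hc : selectionPoint vtx c ∈ (simplexSum vtx).extremePoints ℝ)
    (h : selectionPoint vtx c = selectionPoint vtx d) : c = d := by
  classical
  funext i
  have hx := mem_extremePoints_iff_left.1 hc |>.2
    (selectionPoint vtx (Function.update c i (d i))) (selectionPoint_mem_simplexSum _)
    (selectionPoint vtx (Function.update d i (c i))) (selectionPoint_mem_simplexSum _) (by
      refine ⟨1 / 2, 1 / 2, by norm_num, by norm_num, by norm_num, ?_⟩
      rw [selectionPoint_update, selectionPoint_update, ← h]
      module)
  rw [selectionPoint_update, add_eq_left, sub_eq_zero] at hx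
  have := congrFun hx (vtx i (c i))
  by_contra hne
  rw [Pi.single_eq_same, Pi.single_eq_of_ne (fun h' => hne (hinj i h'))] at this
  exact zero_ne_one this

theorem exists_strictMono_weight {κ : Type*} [Finite κ] {r : κ → κ → Prop} (hr : WellFounded r) :
    ∃ w : κ → ℝ, ∀ x y, r x y → w x < w y := by
  have hirr := hr.transGen.irrefl
  refine ⟨fun x => ({z | Relation.TransGen r z x} : Set κ).ncard, fun x y hxy => ?_⟩
  refine Nat.cast_lt.2 (Set.ncard_lt_ncard ?_ (Set.toFinite _))
  refine ⟨fun z hz => Relation.TransGen.tail hz hxy, fun hsub => ?_⟩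
  exact hirr.irrefl x (hsub (Relation.TransGen.single hxy))

/-- If the sum of the chosen vertices determines the choice, then the choice is realizable:
otherwise rotating the choices along a cycle would give another choice with the same sum. -/
theorem isRealizable_of_unique {ι P κ : Type*} [Fintype ι] [Finite κ] [DecidableEq κ]
    {vtx : ι → P → κ} {c : ι → P}
    (h : ∀ d, selectionPoint vtx c = selectionPoint vtx d → c = d) :
    IsRealizable vtx c := by
  classical
  let r : κ → κ → Prop := fun x y => ∃ i p, p ≠ c i ∧ x = vtx i p ∧ y = vtx i (c i)
  suffices hr : WellFounded r by
    obtain ⟨w, hw⟩ := exists_strictMono_weight hr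
    exact ⟨w, fun i p hp => hw _ _ ⟨i, p, hp, rfl, rfl⟩⟩
  by_contra hr
  rw [WellFounded.wellFounded_iff_has_min] at hr
  push Not at hr
  obtain ⟨S, ⟨x₀, hx₀⟩, hS⟩ := hr
  let I := {i : ι // ∃ p, p ≠ c i ∧ vtx i p ∈ S}
  have hI : ∀ x ∈ S, ∃ i : I, x = vtx i (c i) := by
    intro x hx
    obtain ⟨y, hy, i, p, hp, rfl, rfl⟩ := hS x hx
    exact ⟨⟨i, p, hp, hy⟩, rfl⟩
  choose q hqc hqS using fun i : I => i.2
  choose σ hσ using fun i : I => hI _ (hqS i)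
  have hper : ∃ j : I, j ∈ Function.periodicPts σ := by
    obtain ⟨i, -⟩ := hI x₀ hx₀
    obtain ⟨a, b, hab, he⟩ :=
      Finite.exists_ne_map_eq_of_infinite fun n : ℕ => σ^[n] i
    wlog hlt : a < b generalizing a b
    · exact this b a hab.symm he.symm (lt_of_le_of_ne (not_lt.1 hlt) hab.symm)
    refine ⟨σ^[a] i, Function.mk_mem_periodicPts (Nat.sub_pos_of_lt hlt) ?_⟩
    rw [Function.IsPeriodicPt, Function.IsFixedPt, ← Function.iterate_add_apply,
      Nat.sub_add_cancel hlt.le, ← he]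
  obtain ⟨j, hj⟩ := hper
  let d : ι → P := fun i =>
    if hi : ∃ hi : ∃ p, p ≠ c i ∧ vtx i p ∈ S, (⟨i, hi⟩ : I) ∈ Function.periodicPts σ
    then q ⟨i, hi.1⟩ else c i
  have hd : ∀ i : I, i ∈ Function.periodicPts σ → d i = q i := fun i hi => dif_pos ⟨i.2, hi⟩
  refine hqc j ((hd j hj).symm.trans (congrFun (h d ?_) j).symm)
  have hsub : ∑ i, ((Pi.single (vtx i (d i)) 1 : κ → ℝ) - Pi.single (vtx i (c i)) 1) = 0 := by
    let T : Finset I := Finset.univ.filter (· ∈ Function.periodicPts σ)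
    have hT : ∑ i, ((Pi.single (vtx i (d i)) 1 : κ → ℝ) - Pi.single (vtx i (c i)) 1) =
        ∑ i ∈ T, ((Pi.single (vtx i (d i)) 1 : κ → ℝ) - Pi.single (vtx i (c i)) 1) := by
      symm
      refine (Finset.sum_map T (Function.Embedding.subtype _)
        (fun i => (Pi.single (vtx i (d i)) 1 : κ → ℝ) - Pi.single (vtx i (c i)) 1)).symm.trans ?_
      refine Finset.sum_subset (Finset.subset_univ _) fun i _ hi => ?_
      rw [sub_eq_zero]
      have : d i = c i := dif_neg fun ⟨h₁, h₂⟩ => hi (Finset.mem_map.2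
        ⟨⟨i, h₁⟩, Finset.mem_filter.2 ⟨Finset.mem_univ _, h₂⟩, rfl⟩)
      rw [this]
    rw [hT, Finset.sum_sub_distrib, sub_eq_zero]
    have hb := Function.bijOn_periodicPts σ
    refine Finset.sum_bij (fun i _ => σ i) ?_ ?_ ?_ ?_
    · intro i hi
      exact Finset.mem_filter.2 ⟨Finset.mem_univ _, hb.mapsTo (Finset.mem_filter.1 hi).2⟩
    · intro i hi k hk
      exact hb.injOn (Finset.mem_filter.1 hi).2 (Finset.mem_filter.1 hk).2
    · intro k hk
      obtain ⟨i, hi, hik⟩ := hb.surjOn (Finset.mem_filter.1 hk).2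
      exact ⟨i, Finset.mem_filter.2 ⟨Finset.mem_univ _, hi⟩, hik⟩
    · intro i hi
      rw [hd i (Finset.mem_filter.1 hi).2, hσ i]
  rw [Finset.sum_sub_distrib, sub_eq_zero] at hsub
  exact hsub.symm

/-- The vertices of a sum of simplices correspond to the realizable choices of vertices. -/
theorem card_extremePoints_simplexSum {ι P κ : Type*} [Fintype ι] [Fintype κ] [DecidableEq κ]
    {vtx : ι → P → κ} (hinj : ∀ i, Function.Injective (vtx i)) :
    Nat.card ((simplexSum vtx).extremePoints ℝ) = Nat.card {c : ι → P // IsRealizable vtx c} := by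
  have hb : Set.BijOn (selectionPoint vtx) {c | IsRealizable vtx c}
      ((simplexSum vtx).extremePoints ℝ) := by
    refine ⟨fun c hc => IsRealizable.selectionPoint_mem_extremePoints hc,
      fun c hc d _ h => IsRealizable.eq_of_selectionPoint_eq hc h, fun v hv => ?_⟩
    obtain ⟨c, rfl⟩ := exists_eq_selectionPoint hv
    exact ⟨c, isRealizable_of_unique
      fun d => eq_of_selectionPoint_mem_extremePoints hinj hv, rfl⟩
  exact (Nat.card_congr (hb.equiv _)).symm

/-- The weight `w` respects the strict inequalities prescribed by the relation `r`. -/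
def Respects {V : Type*} (r : V → V → Bool) (w : V → ℝ) : Prop :=
  ∀ x y, r x y = true → w x < w y

/-- Eliminating the variable `v` from the system of strict inequalities `r`. -/
def eliminate {V : Type*} [DecidableEq V] (v : V) (r : V → V → Bool) (x y : V) : Bool :=
  decide (x ≠ v) && decide (y ≠ v) && (r x y || (r x v && r v y))

theorem exists_respects_update_iff {V : Type*} [Fintype V] [DecidableEq V]
    (r : V → V → Bool) (v : V) (w : V → ℝ) :
    (∃ t, Respects r (Function.update w v t)) ↔ r v v = false ∧ Respects (eliminate v r) w := by
  constructor
  · rintro ⟨t, ht⟩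
    refine ⟨Bool.eq_false_iff.2 fun h => (ht v v h).false, fun x y hxy => ?_⟩
    simp only [eliminate, Bool.and_eq_true, decide_eq_true_eq, Bool.or_eq_true] at hxy
    obtain ⟨⟨hx, hy⟩, h | ⟨h₁, h₂⟩⟩ := hxy
    · simpa [hx, hy] using ht x y h
    · simpa [hx, hy] using (ht x v h₁).trans (ht v y h₂)
  · rintro ⟨hv, hw⟩
    obtain ⟨t, hlo, hhi⟩ := Order.exists_between_finsets
      ((Finset.univ.filter fun x => r x v = true).image w)
      ((Finset.univ.filter fun y => r v y = true).image w) (by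
        simp only [Finset.mem_image, Finset.mem_filter, Finset.mem_univ, true_and]
        rintro _ ⟨x, hx, rfl⟩ _ ⟨y, hy, rfl⟩
        refine hw x y ?_
        have hxv : x ≠ v := by rintro rfl; simp [hv] at hx
        have hyv : y ≠ v := by rintro rfl; simp [hv] at hy
        simp [eliminate, hxv, hyv, hx, hy])
    simp only [Finset.mem_image, Finset.mem_filter, Finset.mem_univ, true_and,
      forall_exists_index, and_imp, forall_apply_eq_imp_iff₂] at hlo hhi
    refine ⟨t, fun x y hxy => ?_⟩
    by_cases hx : x = v <;> by_cases hy : y = v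
    · subst hx; subst hy; simp [hv] at hxy
    · subst hx
      simpa [hy] using hhi y hxy
    · subst hy
      simpa [hx] using hlo x hxy
    · simpa [hx, hy] using hw x y (by simp [eliminate, hx, hy, hxy])

/-- A choice of cells in the two blocks between consecutive columns: for the blocks
`i = 0, 1`, the row offset and the column offset of the chosen cell. -/
abbrev BlockChoice := Fin 2 → Fin 2 × Fin 2

/-- The row of the cell with row offset `a` in the block `i`. -/
def blockRow (i a : Fin 2) : Fin 3 := if a = 0 then i.castSucc else i.succ

/-- The column of the cell with column offset `b` in the block `j`. -/
def blockCol {m : ℕ} (j : Fin m) (b : Fin 2) : Fin (m + 1) := if b = 0 then j.castSucc else j.succ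

/-- A system `R` of inequalities on the weights of the first column is compatible with the choice
of maximal cells `c`. -/
def Compatible (R : Fin 3 → Fin 3 → Bool) {m : ℕ} (c : Fin m → BlockChoice) : Prop :=
  ∃ w : Fin (m + 1) → Fin 3 → ℝ, Respects R (w 0) ∧ ∀ j i p, p ≠ c j i →
    w (blockCol j p.2) (blockRow i p.1) < w (blockCol j (c j i).2) (blockRow i (c j i).1)

/-- A cell in a pair of consecutive columns. -/
def pairCell (b : Fin 2) (x : Fin 3) : Fin 3 ⊕ Fin 3 := if b = 0 then Sum.inl x else Sum.inr x

/-- The system `R` as a system on two columns that only constrains the first one. -/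
def leftRel (R : Fin 3 → Fin 3 → Bool) : Fin 3 ⊕ Fin 3 → Fin 3 ⊕ Fin 3 → Bool
  | Sum.inl a, Sum.inl b => R a b
  | _, _ => false

/-- The inequalities on two consecutive columns given by the system `R` on the first one and
the choice `h` of maximal cells. -/
def pairRel (R : Fin 3 → Fin 3 → Bool) (h : BlockChoice) (x y : Fin 3 ⊕ Fin 3) : Bool :=
  leftRel R x y ||
  decide (∃ i p, p ≠ h i ∧ x = pairCell p.2 (blockRow i p.1) ∧
    y = pairCell (h i).2 (blockRow i (h i).1))

/-- The inequalities on the second of two columns, obtained by eliminating the first one. -/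
def nextRel (R : Fin 3 → Fin 3 → Bool) (h : BlockChoice) (a b : Fin 3) : Bool :=
  eliminate (Sum.inl 0) (eliminate (Sum.inl 1) (eliminate (Sum.inl 2) (pairRel R h)))
    (Sum.inr a) (Sum.inr b)

/-- No contradiction arises when eliminating the first of two columns. -/
def stepOk (R : Fin 3 → Fin 3 → Bool) (h : BlockChoice) : Bool :=
  !(pairRel R h (Sum.inl 2) (Sum.inl 2)) &&
  !(eliminate (Sum.inl 2) (pairRel R h) (Sum.inl 1) (Sum.inl 1)) &&
  !(eliminate (Sum.inl 1) (eliminate (Sum.inl 2) (pairRel R h)) (Sum.inl 0) (Sum.inl 0))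

theorem exists_respects_pairRel_iff (R : Fin 3 → Fin 3 → Bool) (h : BlockChoice) (u : Fin 3 → ℝ) :
    (∃ w : Fin 3 → ℝ, Respects (pairRel R h) (Sum.elim w u)) ↔
      stepOk R h = true ∧ Respects (nextRel R h) u := by
  have hupd : ∀ w : Fin 3 → ℝ, Sum.elim w u = Function.update (Function.update (Function.update
      (Sum.elim (0 : Fin 3 → ℝ) u) (Sum.inl 0) (w 0)) (Sum.inl 1) (w 1)) (Sum.inl 2) (w 2) := by
    intro w
    funext x
    rcases x with x | x
    · fin_cases x <;> simp [Function.update]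
    · simp [Function.update]
  have hex : (∃ w : Fin 3 → ℝ, Respects (pairRel R h) (Sum.elim w u)) ↔
      ∃ a b c, Respects (pairRel R h) (Function.update (Function.update (Function.update
      (Sum.elim (0 : Fin 3 → ℝ) u) (Sum.inl 0) a) (Sum.inl 1) b) (Sum.inl 2) c) := by
    constructor
    · rintro ⟨w, hw⟩
      exact ⟨w 0, w 1, w 2, hupd w ▸ hw⟩
    · rintro ⟨a, b, c, hw⟩
      exact ⟨![a, b, c], by rw [hupd]; exact hw⟩
  rw [hex]
  simp only [exists_respects_update_iff, exists_and_left, stepOk, Bool.and_eq_true,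
    Bool.not_eq_true', and_assoc]
  refine and_congr_right fun _ => and_congr_right fun _ => and_congr_right fun _ => ?_
  constructor
  · intro hr a b hab
    exact hr (Sum.inr a) (Sum.inr b) hab
  · rintro hr (x | x) (y | y) hxy
    · fin_cases x <;> simp [eliminate] at hxy
    · fin_cases x <;> simp [eliminate] at hxy
    · fin_cases y <;> simp [eliminate] at hxy
    · exact hr x y hxy

theorem respects_pairRel_iff (R : Fin 3 → Fin 3 → Bool) (h : BlockChoice) (v u : Fin 3 → ℝ) :
    Respects (pairRel R h) (Sum.elim v u) ↔ Respects R v ∧ ∀ i p, p ≠ h i →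
      Sum.elim v u (pairCell p.2 (blockRow i p.1)) <
        Sum.elim v u (pairCell (h i).2 (blockRow i (h i).1)) := by
  constructor
  · intro H
    refine ⟨fun a b hab => H (Sum.inl a) (Sum.inl b) (by simp [pairRel, leftRel, hab]),
      fun i p hp => ?_⟩
    refine H _ _ ?_
    rw [pairRel, Bool.or_eq_true]
    exact Or.inr (decide_eq_true ⟨i, p, hp, rfl, rfl⟩)
  · rintro ⟨hR, hH⟩ x y hxy
    rw [pairRel, Bool.or_eq_true] at hxy
    rcases hxy with hxy | hxy
    · rcases x with x | x <;> rcases y with y | y <;> simp [leftRel] at hxy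
      exact hR x y hxy
    · obtain ⟨i, p, hp, rfl, rfl⟩ := of_decide_eq_true hxy
      exact hH i p hp

theorem compatible_cons_iff (R : Fin 3 → Fin 3 → Bool) {m : ℕ} (h : BlockChoice)
    (c : Fin m → BlockChoice) :
    Compatible R (Fin.cons h c : Fin (m + 1) → BlockChoice) ↔
      stepOk R h = true ∧ Compatible (nextRel R h) c := by
  have key : Compatible R (Fin.cons h c : Fin (m + 1) → BlockChoice) ↔
      ∃ w : Fin (m + 1) → Fin 3 → ℝ,
        (∃ v, Respects (pairRel R h) (Sum.elim v (w 0))) ∧ ∀ j i p, p ≠ c j i →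
        w (blockCol j p.2) (blockRow i p.1) < w (blockCol j (c j i).2) (blockRow i (c j i).1) := by
    have hcell : ∀ (v : Fin 3 → ℝ) (w : Fin (m + 1) → Fin 3 → ℝ) (b : Fin 2) (x : Fin 3),
        Sum.elim v (w 0) (pairCell b x) =
          (Fin.cons v w : Fin (m + 2) → Fin 3 → ℝ) (blockCol 0 b) x := by
      intro v w b x
      fin_cases b <;> simp [pairCell, blockCol]
    have hcol : ∀ (v : Fin 3 → ℝ) (w : Fin (m + 1) → Fin 3 → ℝ) (j : Fin m) (b : Fin 2),
        (Fin.cons v w : Fin (m + 2) → Fin 3 → ℝ) (blockCol j.succ b) = w (blockCol j b) := by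
      intro v w j b
      fin_cases b
      · simp only [blockCol, Fin.zero_eta, if_true, Fin.castSucc_succ, Fin.cons_succ]
      · simp [blockCol]
    rw [Compatible, Fin.exists_fin_succ_pi]
    simp only [respects_pairRel_iff, hcell, Fin.forall_fin_succ (n := m), Fin.cons_zero,
      Fin.cons_succ, hcol]
    rw [exists_comm]
    simp only [← exists_and_right, and_assoc]
  rw [key]
  simp only [exists_respects_pairRel_iff, and_assoc, exists_and_left]
  rfl

open Classical in
/-- The number of choices compatible with the system `R` on the first column. -/
noncomputable def countCompatible (R : Fin 3 → Fin 3 → Bool) (m : ℕ) : ℕ :=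
  ∑ c : Fin m → BlockChoice, if Compatible R c then 1 else 0

theorem countCompatible_succ (R : Fin 3 → Fin 3 → Bool) (m : ℕ) :
    countCompatible R (m + 1) =
      ∑ h : BlockChoice, if stepOk R h = true then countCompatible (nextRel R h) m else 0 := by
  classical
  rw [countCompatible, ← (Fin.consEquiv fun _ => BlockChoice).sum_comp, Fintype.sum_prod_type]
  refine Finset.sum_congr rfl fun h _ => ?_
  have : ∀ c : Fin m → BlockChoice,
      Compatible R ((Fin.consEquiv fun _ => BlockChoice) (h, c)) ↔
      stepOk R h = true ∧ Compatible (nextRel R h) c := fun c => compatible_cons_iff R h c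
  simp only [this]
  split_ifs with hs
  · simp [hs, countCompatible]
  · simp [hs]

theorem countCompatible_zero {R : Fin 3 → Fin 3 → Bool} {w : Fin 3 → ℝ} (hw : Respects R w) :
    countCompatible R 0 = 1 := by
  have : ∀ c : Fin 0 → BlockChoice, Compatible R c := fun c =>
    ⟨fun _ => w, hw, fun j => j.elim0⟩
  simp [countCompatible, this]

/-- The systems on one column that arise by eliminating the preceding columns. -/
def columnState (s : Fin 11) (a b : Fin 3) : Bool :=
  decide ((a, b) ∈ (![[], [(1, 0)], [(1, 2)], [(1, 0), (2, 0)], [(0, 1)], [(0, 2), (1, 2)],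
    [(2, 1)], [(1, 0), (1, 2)], [(1, 0), (2, 1)], [(0, 1), (1, 2)], [(0, 1), (2, 1)]] :
      Fin 11 → List (Fin 3 × Fin 3)) s)

/-- States of the same class have equally many compatible choices. -/
def stateClass : Fin 11 → Fin 6 := ![0, 1, 1, 2, 2, 2, 2, 3, 4, 4, 5]

/-- The state reached from `s` by the choice `h`, if there is one. -/
def transition (s : Fin 11) (h : BlockChoice) : Option (Fin 11) :=
  if stepOk (columnState s) h = true then
    (List.finRange 11).find? fun t => decide (nextRel (columnState s) h = columnState t)
  else none

/-- The number of transitions from a state of class `i` to states of class `j`. -/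
def classMatrix : Fin 6 → Fin 6 → ℕ :=
  ![![4, 2, 4, 1, 2, 1], ![2, 2, 3, 1, 2, 1], ![2, 1, 3, 1, 2, 1], ![1, 2, 2, 1, 2, 1],
    ![1, 1, 2, 1, 2, 1], ![1, 0, 2, 1, 2, 1]]

theorem eq_of_transition_eq_some {s t : Fin 11} {h : BlockChoice} (ht : transition s h = some t) :
    stepOk (columnState s) h = true ∧ nextRel (columnState s) h = columnState t := by
  rw [transition] at ht
  split_ifs at ht with hs
  have := List.find?_some ht
  exact ⟨hs, of_decide_eq_true this⟩

theorem contradiction_of_transition_eq_none : ∀ s h, transition s h = none →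
    stepOk (columnState s) h = false ∨ ∃ a, nextRel (columnState s) h a a = true := by
  decide +kernel

theorem card_transition : ∀ s j,
    (Finset.univ.filter fun h => (transition s h).map stateClass = some j).card =
      classMatrix (stateClass s) j := by
  decide +kernel

/-- The number of choices for `m` pairs of consecutive columns, starting in a state of class `i`. -/
def classCount : ℕ → Fin 6 → ℕ
  | 0, _ => 1
  | m + 1, i => ∑ j, classMatrix i j * classCount m j

theorem exists_respects_columnState : ∀ s, ∃ w : Fin 3 → ℝ, Respects (columnState s) w := by
  have h : ∀ s, ∃ w : Fin 3 → Fin 3, ∀ a b, columnState s a b = true → w a < w b := by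
    decide +kernel
  intro s
  obtain ⟨w, hw⟩ := h s
  exact ⟨fun a => ((w a : ℕ) : ℝ), fun a b hab => Nat.cast_lt.2 (hw a b hab)⟩

theorem countCompatible_eq_zero {R : Fin 3 → Fin 3 → Bool} {a : Fin 3} (ha : R a a = true)
    (m : ℕ) : countCompatible R m = 0 := by
  have : ∀ c : Fin m → BlockChoice, ¬ Compatible R c := fun c ⟨w, hw, _⟩ => (hw a a ha).false
  simp [countCompatible, this]

theorem countCompatible_columnState (s : Fin 11) (m : ℕ) :
    countCompatible (columnState s) m = classCount m (stateClass s) := by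
  induction m generalizing s with
  | zero =>
    obtain ⟨w, hw⟩ := exists_respects_columnState s
    exact countCompatible_zero hw
  | succ m ih =>
    have hterm : ∀ h : BlockChoice, (if stepOk (columnState s) h = true then
        countCompatible (nextRel (columnState s) h) m else 0) =
        ∑ j, if (transition s h).map stateClass = some j then classCount m j else 0 := by
      intro h
      rcases ht : transition s h with _ | t
      · rcases contradiction_of_transition_eq_none s h ht with h₀ | ⟨a, ha⟩
        · simp [h₀]
        · simp [countCompatible_eq_zero ha]
      · obtain ⟨hs, hn⟩ := eq_of_transition_eq_some ht
        simp [hs, hn, ih]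
    rw [countCompatible_succ, Finset.sum_congr rfl fun h _ => hterm h, Finset.sum_comm, classCount]
    refine Finset.sum_congr rfl fun j _ => ?_
    rw [← Finset.sum_filter, Finset.sum_const, card_transition, smul_eq_mul]

theorem classCount_recurrence (m : ℕ) (i : Fin 6) :
    classCount (m + 4) i + 31 * classCount (m + 2) i + 4 * classCount m i =
      13 * classCount (m + 3) i + 20 * classCount (m + 1) i := by
  induction m generalizing i with
  | zero => revert i; decide +kernel
  | succ m ih =>
    have hsucc : ∀ k, classCount (k + 1) i = ∑ j, classMatrix i j * classCount k j := fun _ => rfl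
    have := Finset.sum_congr (rfl : (Finset.univ : Finset (Fin 6)) = _)
      fun j _ => congrArg (classMatrix i j * ·) (ih j)
    simp only [mul_add, Finset.sum_add_distrib, mul_left_comm (classMatrix i _),
      ← Finset.mul_sum, ← hsucc] at this
    rw [show m + 1 + 4 = m + 4 + 1 by rfl, show m + 1 + 2 = m + 2 + 1 by rfl,
      show m + 1 + 3 = m + 3 + 1 by rfl]
    exact this

/-- The cell at position `p` of the block `(j, i)`. -/
def blockCell (m : ℕ) (b : Fin m × Fin 2) (p : Fin 2 × Fin 2) : Fin 3 × Fin (m + 1) :=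
  (blockRow b.2 p.1, blockCol b.1 p.2)

theorem blockCell_injective (m : ℕ) (b : Fin m × Fin 2) : Function.Injective (blockCell m b) := by
  rintro ⟨x, y⟩ ⟨x', y'⟩ h
  obtain ⟨j, i⟩ := b
  simp only [blockCell, Prod.mk.injEq, blockRow, blockCol] at h
  fin_cases x <;> fin_cases y <;> fin_cases x' <;> fin_cases y' <;>
    simp_all [Fin.ext_iff]

theorem Qpolytope_eq_simplexSum (m : ℕ) : Qpolytope (m + 1) = simplexSum (blockCell m) := by
  rw [Qpolytope, simplexSum, Fintype.sum_prod_type_right]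
  refine Finset.sum_congr rfl fun i _ => Finset.sum_congr rfl fun j _ => congrArg _ ?_
  ext x
  simp only [Set.mem_range, Prod.exists, Fin.exists_fin_two, blockCell, blockRow, blockCol,
    Set.mem_insert_iff, Set.mem_singleton_iff, eq_comm (a := x), or_assoc]
  rfl

theorem isRealizable_blockCell_iff (m : ℕ) (c : Fin m × Fin 2 → Fin 2 × Fin 2) :
    IsRealizable (blockCell m) c ↔ Compatible (columnState 0) (Function.curry c) := by
  constructor
  · rintro ⟨w, hw⟩
    exact ⟨fun b a => w (a, b), fun a b hab => by simp [columnState] at hab,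
      fun j i p hp => hw (j, i) p hp⟩
  · rintro ⟨w, -, hw⟩
    exact ⟨fun x => w x.2 x.1, fun b p hp => hw b.1 b.2 p hp⟩

theorem numVerticesQ_succ (m : ℕ) : numVerticesQ (m + 1) = classCount m 0 := by
  classical
  rw [numVerticesQ, Qpolytope_eq_simplexSum, card_extremePoints_simplexSum (blockCell_injective m),
    Nat.card_congr ((Equiv.curry (Fin m) (Fin 2) (Fin 2 × Fin 2)).subtypeEquiv
      (isRealizable_blockCell_iff m)), Nat.card_eq_fintype_card, Fintype.card_subtype,
    Finset.card_filter]
  exact countCompatible_columnState 0 m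

/-- the numbers of vertices `V_n` of `Q_n` satisfy the linear recurrence
`V_{n+4} = 13·V_{n+3} − 31·V_{n+2} + 20·V_{n+1} − 4·V_n` for all `n ≥ 2`, with initial values
`V_2 = 14`, `V_3 = 150`, `V_4 = 1536`, `V_5 = 15594`. -/
theorem numVerticesQ_recurrence :
    (∀ n : ℕ, 2 ≤ n →
      (numVerticesQ (n + 4) : ℤ) =
        13 * (numVerticesQ (n + 3) : ℤ) - 31 * (numVerticesQ (n + 2) : ℤ)
          + 20 * (numVerticesQ (n + 1) : ℤ) - 4 * (numVerticesQ n : ℤ)) ∧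
    numVerticesQ 2 = 14 ∧ numVerticesQ 3 = 150 ∧
    numVerticesQ 4 = 1536 ∧ numVerticesQ 5 = 15594 := by
  refine ⟨fun n hn => ?_, ?_, ?_, ?_, ?_⟩
  · obtain ⟨m, rfl⟩ : ∃ m, n = m + 1 := ⟨n - 1, by omega⟩
    have h := classCount_recurrence m 0
    rw [show m + 1 + 4 = m + 4 + 1 by rfl, show m + 1 + 3 = m + 3 + 1 by rfl,
      show m + 1 + 2 = m + 2 + 1 by rfl]
    simp only [numVerticesQ_succ]
    zify at h
    linarith
  · rw [numVerticesQ_succ 1]; decide +kernel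
  · rw [numVerticesQ_succ 2]; decide +kernel
  · rw [numVerticesQ_succ 3]; decide +kernel
  · rw [numVerticesQ_succ 4]; decide +kernel
end
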